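/- arXiv:1301.1149 — 2 statements merged into one kernel-verified Lean document; each statement's English description precedes it below -/
import Mathlib

section
/- Let g be the finite-dimensional simple Lie algebra of type G₂ over ℂ, and let (h,e,f) be an sl₂-triple in g. Then e lies in the derived subalgebra [g_e,g_e] of the centralizer g_e of e if and only if the Lie subalgebra of g generated by g(1)_e contains g(k)_e for every integer k ≥ 1. -/
/-- The centralizer `g_e` of `e`, i.e. the kernel of `ad e`. -/
noncomputable def centralizer (e : LieAlgebra.g₂ ℂ) : Submodule ℂ (LieAlgebra.g₂ ℂ) :=
  LinearMap.ker (LieAlgebra.ad ℂ (LieAlgebra.g₂ ℂ) e)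

/-- The derived subalgebra `[g_e, g_e]` of the centralizer, as the linear span of all
brackets of pairs of elements of `g_e`. -/
noncomputable def derived (e : LieAlgebra.g₂ ℂ) : Submodule ℂ (LieAlgebra.g₂ ℂ) :=
  Submodule.span ℂ
    {z : LieAlgebra.g₂ ℂ | ∃ x ∈ centralizer e, ∃ y ∈ centralizer e, ⁅x, y⁆ = z}

section LinearAlgebra

variable {K V : Type*} [Field K] [AddCommGroup V] [Module K V]

/-- The span of all commutators of pairs of endomorphisms commuting with `E`. -/
def commutantDerived (E : Module.End K V) : Submodule K (Module.End K V) :=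
  Submodule.span K {Z | ∃ X Y, Commute E X ∧ Commute E Y ∧ X * Y - Y * X = Z}

lemma isNilpotent_of_commutator_eq_two_mul [CharZero K] [FiniteDimensional K V]
    {H E : Module.End K V} (h : H * E - E * H = 2 * E) : IsNilpotent E := by
  by_contra hE
  have hpow (n : ℕ) : H * E ^ n - E ^ n * H = (2 * n : K) • E ^ n := by
    induction n with
    | zero => simp
    | succ n ih =>
      have h' : H * E = E * H + 2 * E := by rw [← h]; abel
      have ih' : H * E ^ n = E ^ n * H + (2 * n : K) • E ^ n := by rw [← ih]; abel
      rw [pow_succ, ← mul_assoc, ih', add_mul, mul_assoc _ H, h', smul_mul_assoc]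
      have : E ^ n * (2 * E) = (2 : K) • (E ^ n * E) := by
        rw [two_mul, mul_add, two_smul]
      rw [mul_add, this, ← mul_assoc, Nat.cast_succ, mul_add, add_smul, mul_one]
      abel
  let T : Module.End K (Module.End K V) := LinearMap.mulLeft K H - LinearMap.mulRight K H
  have hT (n : ℕ) : T.HasEigenvalue (2 * n : K) :=
    Module.End.hasEigenvalue_of_hasEigenvector (x := E ^ n)
      ⟨Module.End.mem_eigenspace_iff.mpr (by simpa [T] using hpow n),
        fun h0 => hE ⟨n, h0⟩⟩
  exact Set.infinite_of_injective_forall_mem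
    (f := fun n : ℕ => (2 * n : K)) (fun m n hmn => by simpa using hmn) hT
    T.finite_hasEigenvalue

/-- If `E` is nilpotent and lies in the span of the commutators of its commutant, then every
size up to its nilpotency index occurs as the size of a Jordan block of `E`. -/
lemma exists_jordan_block_of_mem_commutantDerived [CharZero K] [FiniteDimensional K V]
    {E : Module.End K V} (hE : IsNilpotent E) (hr : E ∈ commutantDerived E) {k : ℕ}
    (hk : E ^ k ≠ 0) :
    ∃ u, E ((E ^ k) u) = 0 ∧ (E ^ k) u ∉ LinearMap.range (E ^ (k + 1)) := by
  by_contra! hc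
  let N : Submodule K V := LinearMap.ker E ⊓ LinearMap.range (E ^ k)
  have hN : N ≤ LinearMap.range (E ^ (k + 1)) := by
    rintro _ ⟨h1, u, rfl⟩
    exact hc u h1
  obtain ⟨p, hp⟩ := N.subtype.exists_leftInverse_of_injective N.ker_subtype
  obtain ⟨t, ht⟩ := (E ^ (k + 1)).rangeRestrict.exists_rightInverse_of_surjective
    (LinearMap.range_rangeRestrict _)
  let P : Module.End K V := N.subtype ∘ₗ p
  let S : Module.End K V := (E ^ k) ∘ₗ t ∘ₗ Submodule.inclusion hN ∘ₗ p
  have hpN (x : N) : p x = x := LinearMap.congr_fun hp x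
  have hPN {x : V} (hx : x ∈ N) : P x = x := congrArg Subtype.val (hpN ⟨x, hx⟩)
  have hPmem (x : V) : P x ∈ N := (p x).2
  have hES : E * S = P := by
    ext x
    have h1 : (E ^ (k + 1)) (t (Submodule.inclusion hN (p x))) = p x :=
      congrArg Subtype.val (LinearMap.congr_fun ht (Submodule.inclusion hN (p x)))
    exact (LinearMap.congr_fun (pow_succ' E k) _).symm.trans h1
  have hEP : E * P = 0 := by
    ext x
    exact (hPmem x).1
  have hPZP {Z : Module.End K V} (hZ : Commute E Z) : P * (Z * P) = Z * P := by
    ext x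
    refine hPN ⟨?_, ?_⟩
    · change (E * Z * P) x = 0
      rw [hZ.eq, mul_assoc, hEP, mul_zero]
      rfl
    · obtain ⟨u, hu⟩ := (hPmem x).2
      exact ⟨Z u, by
        change (E ^ k * Z) u = Z (P x)
        rw [(hZ.pow_left k).eq, ← hu]
        rfl⟩
  let D (Z : Module.End K V) : Module.End K V := Z * S - S * (Z * P)
  have hPD {Z : Module.End K V} (hZ : Commute E Z) : P * D Z = D Z := by
    ext x
    refine hPN ⟨?_, ?_⟩
    · change (E * D Z) x = 0
      have : E * D Z = 0 := by
        simp only [D]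
        rw [mul_sub, ← mul_assoc, hZ.eq, mul_assoc, hES, ← mul_assoc E S, hES, hPZP hZ, sub_self]
      rw [this]
      rfl
    · refine Submodule.sub_mem _ ?_ ⟨_, rfl⟩
      refine ⟨Z (t (Submodule.inclusion hN (p x))), ?_⟩
      change (E ^ k * Z) _ = _
      rw [(hZ.pow_left k).eq]
      rfl
  have key {X Y : Module.End K V} (hX : Commute E X) (hY : Commute E Y) :
      D (X * Y) = D X * (Y * P) + X * D Y := by
    have : S * (X * (Y * P)) = S * ((X * P) * (Y * P)) := by
      rw [mul_assoc X P, hPZP hY]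
    simp only [D]
    rw [sub_mul, mul_sub, mul_assoc S, mul_assoc X, ← this]
    simp only [mul_assoc]
    abel
  have htr {X Y : Module.End K V} (hX : Commute E X) (hY : Commute E Y) :
      LinearMap.trace K V (D X * (Y * P)) = LinearMap.trace K V (Y * D X) := by
    rw [LinearMap.trace_mul_comm, mul_assoc, hPD hX]
  have hD : ∀ Z ∈ commutantDerived E, LinearMap.trace K V (D Z) = 0 := by
    intro Z hZ
    induction hZ using Submodule.span_induction with
    | mem Z hZ =>
      obtain ⟨X, Y, hX, hY, rfl⟩ := hZ
      have : D (X * Y - Y * X) = D (X * Y) - D (Y * X) := by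
        simp only [D]; noncomm_ring
      rw [this, key hX hY, key hY hX, map_sub, map_add, map_add, htr hX hY, htr hY hX]
      ring
    | zero => simp [D]
    | add Z W _ _ h1 h2 =>
      have : D (Z + W) = D Z + D W := by simp only [D]; noncomm_ring
      rw [this, map_add, h1, h2, add_zero]
    | smul c Z _ h =>
      have : D (c • Z) = c • D Z := by simp [D, smul_sub]
      rw [this, map_smul, h, smul_zero]
  have hDE : D E = P := by
    simp only [D]
    rw [hES, hEP, mul_zero, sub_zero]
  have h0 := hD E hr
  rw [hDE, show P = N.subtype ∘ₗ p from rfl, LinearMap.trace_comp_comm', hp,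
    LinearMap.trace_id, Nat.cast_eq_zero, Submodule.finrank_eq_zero] at h0
  have hpow : ∀ n, E ^ (k + n) ≠ 0 := by
    intro n
    induction n with
    | zero => exact hk
    | succ n ih =>
      intro h
      apply ih
      ext x
      have hx : (E ^ (k + n)) x ∈ N :=
        ⟨by
          change (E * E ^ (k + n)) x = 0
          rw [← pow_succ', add_assoc, h]; rfl,
          ⟨(E ^ n) x, by rw [pow_add]; rfl⟩⟩
      rw [h0] at hx
      simpa using hx
  obtain ⟨n, hn⟩ := hE
  exact hpow n (by rw [pow_add, hn, mul_zero])


variable {B : LinearMap.BilinForm K V}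

lemma exists_skew_pairing [FiniteDimensional K V] (hB : B.Nondegenerate) {E : Module.End K V}
    (hE : ∀ x y, B (E x) y = -B x (E y)) (n : ℕ) {a : V} (ha : a ∉ LinearMap.range (E ^ n)) :
    ∃ b, (E ^ n) b = 0 ∧ B b a = 1 := by
  have hEn : ∀ n x y, B ((E ^ n) x) y = (-1) ^ n * B x ((E ^ n) y) := by
    intro n
    induction n with
    | zero => simp
    | succ n ih =>
      intro x y
      rw [pow_succ, Module.End.mul_apply, ih, hE, ← Module.End.mul_apply, ← pow_succ', ← pow_succ,
        pow_succ]
      ring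
  obtain ⟨φ, hφa, hφ⟩ := Submodule.exists_le_ker_of_notMem ha
  let b := (B.toDual hB).symm φ
  have hb (x : V) : B b x = φ x := B.apply_toDual_symm_apply φ x
  refine ⟨(φ a)⁻¹ • b, ?_, ?_⟩
  · rw [map_smul]
    suffices h : (E ^ n) b = 0 by rw [h, smul_zero]
    refine hB.1 _ fun y => ?_
    rw [hEn, hb, LinearMap.mem_ker.mp (hφ ⟨y, rfl⟩), mul_zero]
  · rw [map_smul, LinearMap.smul_apply, hb, smul_eq_mul, inv_mul_cancel₀ hφa]

lemma sq_eq_zero_of_mem_commutantDerived [CharZero K] [FiniteDimensional K V]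
    (hV : Module.finrank K V < 8) (hB : B.Nondegenerate) (hS : ∀ x y, B x y = B y x)
    {E : Module.End K V} (hE : ∀ x y, B (E x) y = -B x (E y)) (hnil : IsNilpotent E)
    (hr : E ∈ commutantDerived E) : E ^ 2 = 0 := by
  by_contra h2
  have h1 : E ^ 1 ≠ 0 := fun h => h2 (by rw [pow_one] at h; simp [h])
  have h0 : E ^ 0 ≠ 0 := fun h => h1 (by rw [pow_succ, h, zero_mul])
  obtain ⟨a, ha, ha'⟩ := exists_jordan_block_of_mem_commutantDerived hnil hr h0
  obtain ⟨b, hb, hb'⟩ := exists_jordan_block_of_mem_commutantDerived hnil hr h1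
  obtain ⟨c, hc, hc'⟩ := exists_jordan_block_of_mem_commutantDerived hnil hr h2
  obtain ⟨a', ha2, haa⟩ := exists_skew_pairing hB hE _ ha'
  obtain ⟨b', hb2, hbb⟩ := exists_skew_pairing hB hE _ hb'
  simp only [pow_zero, pow_one, pow_two, zero_add, Module.End.one_apply, Module.End.mul_apply,
    Nat.reduceAdd] at *
  have hcc : E (E c) ≠ 0 := fun h => hc' (h ▸ Submodule.zero_mem _)
  have alt (x : V) : B (E x) x = 0 := by
    have := hE x x
    rw [hS x, eq_neg_iff_add_eq_zero, ← two_mul] at this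
    simpa using this
  have hli : LinearIndependent K ![c, E c, E (E c), b, E b, b', E b', a] := by
    rw [Fintype.linearIndependent_iff]
    intro g hg
    simp [Fin.sum_univ_eight] at hg
    have g0 : g 0 = 0 := by
      have := congrArg (fun x => E (E x)) hg
      simpa [hc, hb, hb2, ha, hcc] using this
    have e1 : g 1 • E (E c) + g 3 • E b + g 5 • E b' = 0 := by
      simpa [hc, hb, hb2, ha, g0] using congrArg E hg
    have hcb : B (E c) (E b) = 0 := by rw [hE, hb, map_zero, neg_zero]
    have hcb' : B (E c) (E b') = 0 := by rw [hE, hb2, map_zero, neg_zero]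
    have g5 : g 5 = 0 := by
      have := congrArg (fun x => B x b) e1
      simpa [alt, hE _ b, hcb, hbb] using this
    have g3 : g 3 = 0 := by
      have := congrArg (fun x => B x b') e1
      simpa [alt, hE _ b', hcb', hS b, hE b', hbb, g5] using this
    have g1 : g 1 = 0 := by simpa [g3, g5, hcc] using e1
    have e2 : g 2 • E (E c) + g 4 • E b + g 6 • E b' + g 7 • a = 0 := by
      simpa [g0, g1, g3, g5] using hg
    have g7 : g 7 = 0 := by
      have := congrArg (fun x => B x a') e2
      simpa [hE _ a', ha2, hS a, haa] using this
    have g6 : g 6 = 0 := by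
      have := congrArg (fun x => B x b) e2
      simpa [alt, hE _ b, hcb, hbb, g7] using this
    have g4 : g 4 = 0 := by
      have := congrArg (fun x => B x b') e2
      simpa [alt, hE _ b', hcb', hS b, hE b', hbb, g7, g6] using this
    have g2 : g 2 = 0 := by simpa [g4, g6, g7, hcc] using e2
    intro i
    fin_cases i <;> assumption
  have := hli.fintype_card_le_finrank
  simp at this
  omega

lemma exists_mul_mul_eq_smul [CharZero K] [FiniteDimensional K V]
    (hV : Module.finrank K V < 8) (hB : B.Nondegenerate) (hS : ∀ x y, B x y = B y x)
    {E X : Module.End K V} (hE : ∀ x y, B (E x) y = -B x (E y))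
    (hX : ∀ x y, B (X x) y = -B x (X y)) (h2 : E ^ 2 = 0) : ∃ c : K, E * X * E = c • E := by
  have hEE (x : V) : E (E x) = 0 := by simpa [pow_two] using LinearMap.congr_fun h2 x
  by_cases h0 : E = 0
  · exact ⟨0, by simp [h0]⟩
  obtain ⟨b, hb⟩ : ∃ b, E b ≠ 0 := by
    by_contra! h
    exact h0 (LinearMap.ext h)
  obtain ⟨b', -, hbb⟩ := exists_skew_pairing hB hE 2 (a := E b) (by simpa [h2] using hb)
  have alt {X : Module.End K V} (hX : ∀ x y, B (X x) y = -B x (X y)) (x : V) : B (X x) x = 0 := by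
    have := hX x x
    rw [hS x, eq_neg_iff_add_eq_zero, ← two_mul] at this
    simpa using this
  have hskew (x y : V) : B (E x) y = - B (E y) x := by rw [hE, hS]
  rw [hS] at hbb
  have hvan (u v : V) (hu : B (E u) b = 0) (hu' : B (E u) b' = 0) (hv : B (E v) b = 0)
      (hv' : B (E v) b' = 0) : B (E u) v = 0 := by
    by_contra huv
    have hli : LinearIndependent K ![b, b', u, v, E b, E b', E u, E v] := by
      have indep (p q r s : K) (h : p • E b + q • E b' + r • E u + s • E v = 0) :
          p = 0 ∧ q = 0 ∧ r = 0 ∧ s = 0 := by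
        have f (x : V) := congrArg (fun y => B y x) h
        refine ⟨?_, ?_, ?_, ?_⟩
        · simpa [alt hE, hu', hv', hbb] using f b'
        · simpa [alt hE, hu, hv, hbb, hskew b' b] using f b
        · simpa [alt hE, huv, hskew b v, hskew b' v, hv, hv'] using f v
        · simpa [alt hE, huv, hskew b u, hskew b' u, hskew v u, hu, hu'] using f u
      rw [Fintype.linearIndependent_iff]
      intro g hg
      simp [Fin.sum_univ_eight] at hg
      obtain ⟨g0, g1, g2, g3⟩ := indep (g 0) (g 1) (g 2) (g 3) (by simpa [hEE] using congrArg E hg)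
      obtain ⟨g4, g5, g6, g7⟩ := indep (g 4) (g 5) (g 6) (g 7) (by simpa [g0, g1, g2, g3] using hg)
      intro i
      fin_cases i <;> assumption
    have := hli.fintype_card_le_finrank
    simp at this
    omega
  have hform (u : V) : E u = B (E u) b' • E b - B (E u) b • E b' := by
    have hdec (u : V) : ∃ w, u = B (E u) b' • b - B (E u) b • b' + w ∧
        B (E w) b = 0 ∧ B (E w) b' = 0 := by
      refine ⟨u - (B (E u) b' • b - B (E u) b • b'), by abel, ?_, ?_⟩
      · simp [alt hE, hskew b' b, hbb]
      · simp [alt hE, hbb]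
    obtain ⟨w, hw, hwb, hwb'⟩ := hdec u
    have : E w = 0 := by
      refine hB.1 _ fun v => ?_
      obtain ⟨v', hv, hvb, hvb'⟩ := hdec v
      rw [hv, map_add, map_sub, map_smul, map_smul, hwb, hwb', hvan w v' hwb hwb' hvb hvb']
      simp
    conv_lhs => rw [hw]
    simp [this]
  refine ⟨-B (X (E b)) (E b'), LinearMap.ext fun u => ?_⟩
  have h1 : E (X (E b)) = -B (X (E b)) (E b') • E b := by
    rw [hform (X (E b)), hE _ b, hE _ b', alt hX]
    simp
  have h3 : E (X (E b')) = -B (X (E b)) (E b') • E b' := by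
    rw [hform (X (E b')), hE _ b, hE _ b', alt hX, hX, hS (E b')]
    simp
  simp only [Module.End.mul_apply, LinearMap.smul_apply]
  rw [hform u, map_sub, map_sub, map_smul, map_smul, map_smul, map_smul, h1, h3, smul_sub,
    smul_comm, smul_comm (B (E u) b)]

end LinearAlgebra

section SlTwo

variable {K L : Type*} [Field K] [LieRing L] [LieAlgebra K L] {h e f : L}

lemma lie_lie_lie_lie_of_lie_eq_zero (hhf : ⁅h, f⁆ = (-2 : K) • f) (hhe : ⁅h, e⁆ = (2 : K) • e)
    (hef : ⁅e, f⁆ = h) {x : L} (hx : ⁅e, x⁆ = 0) :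
    ⁅e, ⁅e, ⁅f, ⁅f, x⁆⁆⁆⁆ = (2 : K) • (⁅h, ⁅h, x⁆⁆ - ⁅h, x⁆) := by
  have heh (y : L) (hy : ⁅e, y⁆ = 0) : ⁅e, ⁅h, y⁆⁆ = 0 := by
    rw [leibniz_lie, hy, lie_zero, add_zero, ← lie_skew e h, hhe, neg_lie, smul_lie, hy, smul_zero,
      neg_zero]
  have h1 (y : L) (hy : ⁅e, y⁆ = 0) : ⁅e, ⁅f, y⁆⁆ = ⁅h, y⁆ := by
    rw [leibniz_lie, hef, hy, lie_zero, add_zero]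
  rw [leibniz_lie e f, hef, h1 x hx, leibniz_lie h f, hhf, smul_lie, lie_add, lie_add, lie_smul,
    h1 x hx, h1 _ (heh x hx)]
  module

/-- If `(ad e)²` has image in the line through `e`, the centralizer of `e` splits into
`h`-eigenspaces of weights `0`, `1` and the line through `e`. -/
lemma exists_eq_add_add_of_lie_eq_zero [CharZero K] (hhf : ⁅h, f⁆ = (-2 : K) • f)
    (hhe : ⁅h, e⁆ = (2 : K) • e) (hef : ⁅e, f⁆ = h) (hmin : ∀ x : L, ∃ c : K, ⁅e, ⁅e, x⁆⁆ = c • e)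
    {x : L} (hx : ⁅e, x⁆ = 0) :
    ∃ (x₀ x₁ : L) (c : K), x = x₀ + x₁ + c • e ∧ ⁅e, x₀⁆ = 0 ∧ ⁅e, x₁⁆ = 0 ∧ ⁅h, x₀⁆ = 0 ∧
      ⁅h, x₁⁆ = x₁ := by
  obtain ⟨c, hc⟩ := hmin ⁅f, ⁅f, x⁆⁆
  rw [lie_lie_lie_lie_of_lie_eq_zero hhf hhe hef hx] at hc
  have hT : ⁅h, ⁅h, x⁆⁆ = ⁅h, x⁆ + (c / 2) • e := by
    have : (2⁻¹ : K) • (2 : K) • (⁅h, ⁅h, x⁆⁆ - ⁅h, x⁆) = (2⁻¹ : K) • c • e := by rw [hc]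
    rw [smul_smul, inv_mul_cancel₀ two_ne_zero, one_smul, sub_eq_iff_eq_add'] at this
    rw [this]
    module
  have hehx : ⁅e, ⁅h, x⁆⁆ = 0 := by
    rw [leibniz_lie, hx, lie_zero, add_zero, ← lie_skew e h, hhe, neg_lie, smul_lie, hx, smul_zero,
      neg_zero]
  refine ⟨x - ⁅h, x⁆ + (c / 4) • e, ⁅h, x⁆ - (c / 2) • e, c / 4, by module, ?_, ?_, ?_, ?_⟩
  · simp [hx, hehx]
  · simp [hehx]
  · rw [lie_add, lie_sub, hT, lie_smul, hhe]
    module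
  · rw [lie_sub, hT, lie_smul, hhe]
    module

lemma mem_lieSpan_of_mem_span_lie [CharZero K] (hhf : ⁅h, f⁆ = (-2 : K) • f)
    (hhe : ⁅h, e⁆ = (2 : K) • e) (hef : ⁅e, f⁆ = h) (hmin : ∀ x : L, ∃ c : K, ⁅e, ⁅e, x⁆⁆ = c • e)
    (he : e ∈ Submodule.span K {z : L | ∃ x y : L, ⁅e, x⁆ = 0 ∧ ⁅e, y⁆ = 0 ∧ ⁅x, y⁆ = z}) :
    e ∈ LieSubalgebra.lieSpan K L {x : L | ⁅e, x⁆ = 0 ∧ ⁅h, x⁆ = x} := by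
  set S := LieSubalgebra.lieSpan K L {x : L | ⁅e, x⁆ = 0 ∧ ⁅h, x⁆ = x}
  let T : Module.End K L := (LieAlgebra.ad K L h) ∘ₗ (LieAlgebra.ad K L h) - LieAlgebra.ad K L h
  have hTa (x : L) : T x = ⁅h, ⁅h, x⁆⁆ - ⁅h, x⁆ := rfl
  have key : Submodule.span K {z : L | ∃ x y : L, ⁅e, x⁆ = 0 ∧ ⁅e, y⁆ = 0 ∧ ⁅x, y⁆ = z} ≤
      S.toSubmodule.comap T := by
    rw [Submodule.span_le]
    rintro _ ⟨x, y, hx, hy, rfl⟩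
    obtain ⟨x₀, x₁, a, rfl, hx₀, hx₁, hhx₀, hhx₁⟩ :=
      exists_eq_add_add_of_lie_eq_zero hhf hhe hef hmin hx
    obtain ⟨y₀, y₁, b, rfl, hy₀, hy₁, hhy₀, hhy₁⟩ :=
      exists_eq_add_add_of_lie_eq_zero hhf hhe hef hmin hy
    have hx₀' : ⁅x₀, e⁆ = 0 := by rw [← lie_skew, hx₀, neg_zero]
    have hx₁' : ⁅x₁, e⁆ = 0 := by rw [← lie_skew, hx₁, neg_zero]
    have h00 : ⁅h, ⁅x₀, y₀⁆⁆ = 0 := by rw [leibniz_lie, hhx₀, hhy₀, zero_lie, lie_zero, add_zero]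
    have h01 : ⁅h, ⁅x₀, y₁⁆⁆ = ⁅x₀, y₁⁆ := by rw [leibniz_lie, hhx₀, hhy₁, zero_lie, zero_add]
    have h10 : ⁅h, ⁅x₁, y₀⁆⁆ = ⁅x₁, y₀⁆ := by rw [leibniz_lie, hhx₁, hhy₀, lie_zero, add_zero]
    have h11 : ⁅h, ⁅x₁, y₁⁆⁆ = ⁅x₁, y₁⁆ + ⁅x₁, y₁⁆ := by rw [leibniz_lie, hhx₁, hhy₁]
    have : T ⁅x₀ + x₁ + a • e, y₀ + y₁ + b • e⁆ = (2 : K) • ⁅x₁, y₁⁆ := by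
      rw [hTa]
      simp only [add_lie, lie_add, smul_lie, lie_smul, hx₀', hx₁', hy₀, hy₁, lie_self, smul_zero,
        add_zero, h00, h01, h10, h11, lie_zero]
      module
    change T _ ∈ S
    rw [this]
    exact S.smul_mem _ (S.lie_mem (LieSubalgebra.subset_lieSpan ⟨hx₁, hhx₁⟩)
      (LieSubalgebra.subset_lieSpan ⟨hy₁, hhy₁⟩))
  have hTe : T e ∈ S := key he
  have : T e = (2 : K) • e := by
    rw [hTa, hhe, lie_smul, hhe]
    module
  rw [this] at hTe
  simpa [smul_smul] using S.smul_mem (2⁻¹ : K) hTe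

/-- The positive part of the centralizer of an element `e` for which `(ad e)²` has image in the
line through `e` is generated in degree one as soon as `e` is reachable. -/
lemma mem_lieSpan_of_lie_eq_smul [CharZero K] (hhf : ⁅h, f⁆ = (-2 : K) • f)
    (hhe : ⁅h, e⁆ = (2 : K) • e) (hef : ⁅e, f⁆ = h) (hmin : ∀ x : L, ∃ c : K, ⁅e, ⁅e, x⁆⁆ = c • e)
    (he : e ∈ Submodule.span K {z : L | ∃ x y : L, ⁅e, x⁆ = 0 ∧ ⁅e, y⁆ = 0 ∧ ⁅x, y⁆ = z})
    {k : ℤ} (hk : 1 ≤ k) {x : L} (hx : ⁅e, x⁆ = 0) (hhx : ⁅h, x⁆ = (k : K) • x) :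
    x ∈ LieSubalgebra.lieSpan K L {x : L | ⁅e, x⁆ = 0 ∧ ⁅h, x⁆ = x} := by
  rcases hk.eq_or_lt with rfl | hk
  · exact LieSubalgebra.subset_lieSpan ⟨hx, by simpa using hhx⟩
  obtain ⟨c, hc⟩ := hmin ⁅f, ⁅f, x⁆⁆
  rw [lie_lie_lie_lie_of_lie_eq_zero hhf hhe hef hx, hhx, lie_smul, hhx] at hc
  have hk' : (2 * (k * (k - 1)) : K) ≠ 0 := by
    have : (2 * (k * (k - 1)) : ℤ) ≠ 0 := by
      have := mul_pos (by omega : 0 < k) (by omega : 0 < k - 1)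
      omega
    exact_mod_cast this
  have hx' : x = ((2 * (k * (k - 1)) : K)⁻¹ * c) • e := by
    rw [mul_smul, ← hc, eq_inv_smul_iff₀ hk']
    module
  rw [hx']
  exact LieSubalgebra.smul_mem _ _ (mem_lieSpan_of_mem_span_lie hhf hhe hef hmin he)

/-- If `e` lies in the Lie subalgebra generated by the weight one part of its centralizer, then
`e` is reachable. -/
lemma mem_span_lie_of_mem_lieSpan (hhe : ⁅h, e⁆ = (2 : K) • e)
    (he : e ∈ LieSubalgebra.lieSpan K L {x : L | ⁅e, x⁆ = 0 ∧ ⁅h, x⁆ = x}) :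
    e ∈ Submodule.span K {z : L | ∃ x y : L, ⁅e, x⁆ = 0 ∧ ⁅e, y⁆ = 0 ∧ ⁅x, y⁆ = z} := by
  set D := Submodule.span K {z : L | ∃ x y : L, ⁅e, x⁆ = 0 ∧ ⁅e, y⁆ = 0 ∧ ⁅x, y⁆ = z}
  have hcent (x y : L) (hx : ⁅e, x⁆ = 0) (hy : ⁅e, y⁆ = 0) : ⁅e, ⁅x, y⁆⁆ = 0 := by
    rw [leibniz_lie, hx, hy, zero_lie, lie_zero, add_zero]
  have heh (x : L) (hx : ⁅e, x⁆ = 0) : ⁅e, ⁅h, x⁆⁆ = 0 := by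
    rw [leibniz_lie, hx, lie_zero, add_zero, ← lie_skew e h, hhe, neg_lie, smul_lie, hx, smul_zero,
      neg_zero]
  have hhD : D ≤ D.comap (LieAlgebra.ad K L h : L →ₗ[K] L) := by
    rw [Submodule.span_le]
    rintro _ ⟨x, y, hx, hy, rfl⟩
    change ⁅h, ⁅x, y⁆⁆ ∈ D
    rw [leibniz_lie]
    exact D.add_mem (Submodule.subset_span ⟨_, _, heh x hx, hy, rfl⟩)
      (Submodule.subset_span ⟨_, _, hx, heh y hy, rfl⟩)
  have key : ∀ x ∈ LieSubalgebra.lieSpan K L {x : L | ⁅e, x⁆ = 0 ∧ ⁅h, x⁆ = x},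
      ⁅e, x⁆ = 0 ∧ ∃ x₁, ⁅h, x₁⁆ = x₁ ∧ x - x₁ ∈ D := by
    intro x hx
    induction hx using LieSubalgebra.lieSpan_induction with
    | mem x hx => exact ⟨hx.1, x, hx.2, by simp⟩
    | zero => exact ⟨lie_zero _, 0, lie_zero _, by simp⟩
    | add x y _ _ hx hy =>
      obtain ⟨hx, x₁, hx₁, hxD⟩ := hx
      obtain ⟨hy, y₁, hy₁, hyD⟩ := hy
      exact ⟨by rw [lie_add, hx, hy, add_zero], x₁ + y₁, by rw [lie_add, hx₁, hy₁],
        by simpa [add_sub_add_comm] using D.add_mem hxD hyD⟩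
    | smul c x _ hx =>
      obtain ⟨hx, x₁, hx₁, hxD⟩ := hx
      exact ⟨by rw [lie_smul, hx, smul_zero], c • x₁, by rw [lie_smul, hx₁],
        by simpa [smul_sub] using D.smul_mem c hxD⟩
    | lie x y _ _ hx hy =>
      exact ⟨hcent _ _ hx.1 hy.1, 0, lie_zero _,
        by rw [sub_zero]; exact Submodule.subset_span ⟨x, y, hx.1, hy.1, rfl⟩⟩
  obtain ⟨-, x₁, hx₁, hD⟩ := key e he
  have : ⁅h, e - x₁⁆ ∈ D := hhD hD
  have h2 : e = ⁅h, e - x₁⁆ - (e - x₁) := by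
    rw [lie_sub, hhe, hx₁]
    module
  rw [h2]
  exact D.sub_mem this hD

end SlTwo

section SerreG₂

variable {K L : Type*} [Field K] [LieRing L] [LieAlgebra K L]

/-- Elements of a Lie ring satisfying the Serre relations of type `G₂`; `a`, `p`, `u` belong to the
short simple root and `b`, `q`, `v` to the long one. -/
structure IsG₂System {L : Type*} [LieRing L] (a b u v p q : L) : Prop where
  lie_a_p : ⁅a, p⁆ = u
  lie_b_q : ⁅b, q⁆ = v
  lie_a_q : ⁅a, q⁆ = 0
  lie_b_p : ⁅b, p⁆ = 0
  lie_u_a : ⁅u, a⁆ = (2 : ℤ) • a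
  lie_u_b : ⁅u, b⁆ = (-3 : ℤ) • b
  lie_v_a : ⁅v, a⁆ = (-1 : ℤ) • a
  lie_v_b : ⁅v, b⁆ = (2 : ℤ) • b
  lie_u_p : ⁅u, p⁆ = (-2 : ℤ) • p
  lie_u_q : ⁅u, q⁆ = (3 : ℤ) • q
  lie_v_p : ⁅v, p⁆ = (1 : ℤ) • p
  lie_v_q : ⁅v, q⁆ = (-2 : ℤ) • q
  serre_a : ⁅a, ⁅a, ⁅a, ⁅a, b⁆⁆⁆⁆ = 0
  serre_b : ⁅b, ⁅b, a⁆⁆ = 0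
  serre_p : ⁅p, ⁅p, ⁅p, ⁅p, q⁆⁆⁆⁆ = 0
  serre_q : ⁅q, ⁅q, p⁆⁆ = 0

/-- The elements of the Chevalley basis of `G₂`, up to scalars. -/
def chevalleyG₂ {L : Type*} [LieRing L] (a b u v p q : L) : Fin 14 → L :=
  ![a, b, ⁅a, b⁆, ⁅a, ⁅a, b⁆⁆, ⁅a, ⁅a, ⁅a, b⁆⁆⁆, ⁅b, ⁅a, ⁅a, ⁅a, b⁆⁆⁆⁆,
    p, q, ⁅p, q⁆, ⁅p, ⁅p, q⁆⁆, ⁅p, ⁅p, ⁅p, q⁆⁆⁆, ⁅q, ⁅p, ⁅p, ⁅p, q⁆⁆⁆⁆, u, v]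

lemma map_chevalleyG₂ {L L' F : Type*} [LieRing L] [LieRing L'] [FunLike F L L'] (φ : F)
    (hφ : ∀ x y, φ ⁅x, y⁆ = ⁅φ x, φ y⁆) (a b u v p q : L) (i : Fin 14) :
    φ (chevalleyG₂ a b u v p q i) = chevalleyG₂ (φ a) (φ b) (φ u) (φ v) (φ p) (φ q) i := by
  fin_cases i <;> simp [chevalleyG₂, hφ]

namespace IsG₂System

variable {a b u v p q : L}

lemma swap (H : IsG₂System a b u v p q) : IsG₂System p q (-u) (-v) a b where
  lie_a_p := by rw [← lie_skew, H.lie_a_p]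
  lie_b_q := by rw [← lie_skew, H.lie_b_q]
  lie_a_q := by rw [← lie_skew, H.lie_b_p, neg_zero]
  lie_b_p := by rw [← lie_skew, H.lie_a_q, neg_zero]
  lie_u_a := by rw [neg_lie, H.lie_u_p]; module
  lie_u_b := by rw [neg_lie, H.lie_u_q]; module
  lie_v_a := by rw [neg_lie, H.lie_v_p]; module
  lie_v_b := by rw [neg_lie, H.lie_v_q]; module
  lie_u_p := by rw [neg_lie, H.lie_u_a]; module
  lie_u_q := by rw [neg_lie, H.lie_u_b]; module
  lie_v_p := by rw [neg_lie, H.lie_v_a]; module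
  lie_v_q := by rw [neg_lie, H.lie_v_b]; module
  serre_a := H.serre_p
  serre_b := H.serre_q
  serre_p := H.serre_a
  serre_q := H.serre_b

lemma map (H : IsG₂System a b u v p q) {L' : Type*} [LieRing L'] (φ : L →+ L')
    (hφ : ∀ x y, φ ⁅x, y⁆ = ⁅φ x, φ y⁆) :
    IsG₂System (φ a) (φ b) (φ u) (φ v) (φ p) (φ q) where
  lie_a_p := by rw [← hφ, H.lie_a_p]
  lie_b_q := by rw [← hφ, H.lie_b_q]
  lie_a_q := by rw [← hφ, H.lie_a_q, map_zero]
  lie_b_p := by rw [← hφ, H.lie_b_p, map_zero]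
  lie_u_a := by rw [← hφ, H.lie_u_a, map_zsmul]
  lie_u_b := by rw [← hφ, H.lie_u_b, map_zsmul]
  lie_v_a := by rw [← hφ, H.lie_v_a, map_zsmul]
  lie_v_b := by rw [← hφ, H.lie_v_b, map_zsmul]
  lie_u_p := by rw [← hφ, H.lie_u_p, map_zsmul]
  lie_u_q := by rw [← hφ, H.lie_u_q, map_zsmul]
  lie_v_p := by rw [← hφ, H.lie_v_p, map_zsmul]
  lie_v_q := by rw [← hφ, H.lie_v_q, map_zsmul]
  serre_a := by simp only [← hφ, H.serre_a, map_zero]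
  serre_b := by simp only [← hφ, H.serre_b, map_zero]
  serre_p := by simp only [← hφ, H.serre_p, map_zero]
  serre_q := by simp only [← hφ, H.serre_q, map_zero]

lemma lie_u_v (H : IsG₂System a b u v p q) : ⁅u, v⁆ = 0 := by
  rw [← H.lie_b_q, leibniz_lie, H.lie_u_b, H.lie_u_q, zsmul_lie, lie_zsmul]; module

lemma lie_b_ab (H : IsG₂System a b u v p q) : ⁅b, ⁅a, b⁆⁆ = 0 := by
  rw [← lie_skew a b, lie_neg, H.serre_b, neg_zero]

lemma lie_b_aab (H : IsG₂System a b u v p q) : ⁅b, ⁅a, ⁅a, b⁆⁆⁆ = 0 := by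
  rw [leibniz_lie, H.lie_b_ab, lie_zero, add_zero, ← lie_skew b a, neg_lie, lie_self, neg_zero]

lemma lie_b_aaab (H : IsG₂System a b u v p q) :
    ⁅b, ⁅a, ⁅a, ⁅a, b⁆⁆⁆⁆ = -⁅⁅a, b⁆, ⁅a, ⁅a, b⁆⁆⁆ := by
  rw [leibniz_lie, H.lie_b_aab, lie_zero, add_zero, ← lie_skew b a, neg_lie]

lemma lie_b_baaab (H : IsG₂System a b u v p q) : ⁅b, ⁅b, ⁅a, ⁅a, ⁅a, b⁆⁆⁆⁆⁆ = 0 := by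
  rw [H.lie_b_aaab, lie_neg, leibniz_lie, H.lie_b_ab, H.lie_b_aab, zero_lie, lie_zero, add_zero,
    neg_zero]

lemma lie_a_baaab [CharZero K] (H : IsG₂System a b u v p q) : ⁅a, ⁅b, ⁅a, ⁅a, ⁅a, b⁆⁆⁆⁆⁆ = 0 := by
  have h₁ : ⁅a, ⁅b, ⁅a, ⁅a, ⁅a, b⁆⁆⁆⁆⁆ = ⁅⁅a, b⁆, ⁅a, ⁅a, ⁅a, b⁆⁆⁆⁆ := by
    rw [leibniz_lie, H.serre_a, lie_zero, add_zero]
  have h₂ : ⁅a, ⁅b, ⁅a, ⁅a, ⁅a, b⁆⁆⁆⁆⁆ = -⁅⁅a, b⁆, ⁅a, ⁅a, ⁅a, b⁆⁆⁆⁆ := by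
    rw [H.lie_b_aaab, lie_neg, leibniz_lie, lie_self, zero_add]
  have : (2 : K) • ⁅⁅a, b⁆, ⁅a, ⁅a, ⁅a, b⁆⁆⁆⁆ = 0 := by
    rw [two_smul]; nth_rw 1 [← h₁]; rw [h₂, neg_add_cancel]
  rw [h₁]
  simpa using this

lemma lie_a_pq (H : IsG₂System a b u v p q) : ⁅a, ⁅p, q⁆⁆ = (3 : ℤ) • q := by
  rw [leibniz_lie, H.lie_a_p, H.lie_a_q, H.lie_u_q, lie_zero, add_zero]

lemma lie_u_pq (H : IsG₂System a b u v p q) : ⁅u, ⁅p, q⁆⁆ = ⁅p, q⁆ := by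
  rw [leibniz_lie, H.lie_u_p, H.lie_u_q, zsmul_lie, lie_zsmul]; module

lemma lie_u_ppq (H : IsG₂System a b u v p q) : ⁅u, ⁅p, ⁅p, q⁆⁆⁆ = -⁅p, ⁅p, q⁆⁆ := by
  rw [leibniz_lie, H.lie_u_p, H.lie_u_pq, zsmul_lie]; module

lemma lie_a_ppq (H : IsG₂System a b u v p q) : ⁅a, ⁅p, ⁅p, q⁆⁆⁆ = (4 : ℤ) • ⁅p, q⁆ := by
  rw [leibniz_lie, H.lie_a_p, H.lie_a_pq, H.lie_u_pq, lie_zsmul]; module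

lemma lie_a_pppq (H : IsG₂System a b u v p q) :
    ⁅a, ⁅p, ⁅p, ⁅p, q⁆⁆⁆⁆ = (3 : ℤ) • ⁅p, ⁅p, q⁆⁆ := by
  rw [leibniz_lie, H.lie_a_p, H.lie_a_ppq, H.lie_u_ppq, lie_zsmul]; module

lemma lie_a_qpppq (H : IsG₂System a b u v p q) : ⁅a, ⁅q, ⁅p, ⁅p, ⁅p, q⁆⁆⁆⁆⁆ = 0 := by
  rw [leibniz_lie, H.lie_a_q, H.lie_a_pppq, lie_zsmul, H.swap.lie_b_aab, zero_lie, smul_zero,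
    add_zero]

lemma lie_b_pq (H : IsG₂System a b u v p q) : ⁅b, ⁅p, q⁆⁆ = -p := by
  rw [leibniz_lie, H.lie_b_p, H.lie_b_q, zero_lie, ← lie_skew, H.lie_v_p]; module

lemma lie_b_ppq (H : IsG₂System a b u v p q) : ⁅b, ⁅p, ⁅p, q⁆⁆⁆ = 0 := by
  rw [leibniz_lie, H.lie_b_p, H.lie_b_pq, zero_lie, lie_neg, lie_self]; simp

lemma lie_b_pppq (H : IsG₂System a b u v p q) : ⁅b, ⁅p, ⁅p, ⁅p, q⁆⁆⁆⁆ = 0 := by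
  rw [leibniz_lie, H.lie_b_p, H.lie_b_ppq, zero_lie, lie_zero, add_zero]

lemma lie_v_pppq (H : IsG₂System a b u v p q) :
    ⁅v, ⁅p, ⁅p, ⁅p, q⁆⁆⁆⁆ = ⁅p, ⁅p, ⁅p, q⁆⁆⁆ := by
  simp only [leibniz_lie v, H.lie_v_p, H.lie_v_q, zsmul_lie, lie_zsmul, lie_add]; module

lemma lie_b_qpppq (H : IsG₂System a b u v p q) :
    ⁅b, ⁅q, ⁅p, ⁅p, ⁅p, q⁆⁆⁆⁆⁆ = ⁅p, ⁅p, ⁅p, q⁆⁆⁆ := by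
  rw [leibniz_lie, H.lie_b_q, H.lie_b_pppq, H.lie_v_pppq, lie_zero, add_zero]

lemma lie_mem [CharZero K] (H : IsG₂System a b u v p q) (S : Submodule K L)
    (hS : ∀ i, chevalleyG₂ a b u v p q i ∈ S) (i : Fin 14) :
    ⁅a, chevalleyG₂ a b u v p q i⁆ ∈ S ∧ ⁅b, chevalleyG₂ a b u v p q i⁆ ∈ S := by
  have hz (n : ℤ) {x : L} (hx : x ∈ S) : n • x ∈ S := S.toAddSubgroup.zsmul_mem hx n
  simp only [Fin.forall_fin_succ, chevalleyG₂] at hS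
  simp at hS
  obtain ⟨h0, h1, h2, h3, h4, h5, h6, h7, h8, h9, h10, h11, h12, h13⟩ := hS
  have hba : ⁅b, a⁆ = -⁅a, b⁆ := (lie_skew b a).symm
  have hau : ⁅a, u⁆ = (-2 : ℤ) • a := by rw [← lie_skew, H.lie_u_a]; module
  have hav : ⁅a, v⁆ = (1 : ℤ) • a := by rw [← lie_skew, H.lie_v_a]; module
  have hbu : ⁅b, u⁆ = (3 : ℤ) • b := by rw [← lie_skew, H.lie_u_b]; module
  have hbv : ⁅b, v⁆ = (-2 : ℤ) • b := by rw [← lie_skew, H.lie_v_b]; module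
  fin_cases i <;> simp only [chevalleyG₂, Fin.reduceFinMk, Matrix.cons_val, hba, hau, hav, hbu, hbv,
    H.lie_a_p, H.lie_a_q, H.lie_b_p, H.lie_b_q, H.serre_a, H.lie_b_ab, H.lie_b_aab, H.lie_b_baaab,
    H.lie_a_baaab (K := K), H.lie_a_pq, H.lie_a_ppq, H.lie_a_pppq, H.lie_a_qpppq, H.lie_b_pq,
    H.lie_b_ppq, H.lie_b_pppq, H.lie_b_qpppq, lie_self]
  all_goals constructor
  all_goals simp only [S.neg_mem_iff, S.zero_mem, hz, h0, h1, h2, h3, h4, h5, h6, h7, h8, h9, h10,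
    h12, h13]

lemma chevalleyG₂_swap_mem (S : Submodule K L)
    (hS : ∀ i, chevalleyG₂ a b u v p q i ∈ S) (i : Fin 14) :
    chevalleyG₂ p q (-u) (-v) a b i ∈ S := by
  simp only [Fin.forall_fin_succ, chevalleyG₂] at hS
  simp at hS
  fin_cases i <;> simp [chevalleyG₂, hS]

/-- A Lie algebra generated by a `G₂`-system is spanned by the corresponding fourteen elements. -/
theorem span_chevalleyG₂_eq_top [CharZero K] (H : IsG₂System a b u v p q)
    (htop : LieSubalgebra.lieSpan K L {a, b, p, q} = ⊤) :
    Submodule.span K (Set.range (chevalleyG₂ a b u v p q)) = ⊤ := by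
  set S := Submodule.span K (Set.range (chevalleyG₂ a b u v p q))
  have hS (i) : chevalleyG₂ a b u v p q i ∈ S := Submodule.subset_span ⟨i, rfl⟩
  have hS' := chevalleyG₂_swap_mem S hS
  have hspan : S = Submodule.span K (Set.range (chevalleyG₂ p q (-u) (-v) a b)) := by
    refine le_antisymm (Submodule.span_le.2 ?_) (Submodule.span_le.2 ?_)
    · rintro _ ⟨i, rfl⟩
      simpa using chevalleyG₂_swap_mem (a := p) (b := q) (u := -u) (v := -v) (p := a) (q := b)
        (Submodule.span K (Set.range (chevalleyG₂ p q (-u) (-v) a b)))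
        (fun i ↦ Submodule.subset_span ⟨i, rfl⟩) i
    · rintro _ ⟨i, rfl⟩
      exact hS' i
  have hpos (x : L) (hx : x = a ∨ x = b) : S ≤ S.comap (LieAlgebra.ad K L x : L →ₗ[K] L) := by
    refine Submodule.span_le.2 ?_
    rintro _ ⟨i, rfl⟩
    obtain rfl | rfl := hx
    exacts [(H.lie_mem S hS i).1, (H.lie_mem S hS i).2]
  have hneg (x : L) (hx : x = p ∨ x = q) : S ≤ S.comap (LieAlgebra.ad K L x : L →ₗ[K] L) := by
    nth_rw 1 [hspan]
    refine Submodule.span_le.2 ?_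
    rintro _ ⟨i, rfl⟩
    obtain rfl | rfl := hx
    exacts [(H.swap.lie_mem S hS' i).1, (H.swap.lie_mem S hS' i).2]
  have hstab : ∀ x ∈ LieSubalgebra.lieSpan K L {a, b, p, q}, ∀ s ∈ S, ⁅x, s⁆ ∈ S := by
    intro x hx
    induction hx using LieSubalgebra.lieSpan_induction with
    | mem x hx =>
      rcases hx with hx | hx | hx | hx
      exacts [hpos x (.inl hx), hpos x (.inr hx), hneg x (.inl hx), hneg x (.inr hx)]
    | zero => simp
    | add x y _ _ hx hy => exact fun s hs ↦ by simpa using S.add_mem (hx s hs) (hy s hs)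
    | smul c x _ hx => exact fun s hs ↦ by simpa using S.smul_mem c (hx s hs)
    | lie x y _ _ hx hy =>
      exact fun s hs ↦ by simpa using S.sub_mem (hx _ (hy s hs)) (hy _ (hx s hs))
  have hmem : ∀ x ∈ LieSubalgebra.lieSpan K L {a, b, p, q}, x ∈ S := by
    intro x hx
    induction hx using LieSubalgebra.lieSpan_induction with
    | mem x hx =>
      rcases hx with rfl | rfl | rfl | rfl
      exacts [hS 0, hS 1, hS 6, hS 7]
    | zero => exact S.zero_mem
    | add x y _ _ hx hy => exact S.add_mem hx hy
    | smul c x _ hx => exact S.smul_mem c hx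
    | lie x y hx _ _ hy => exact hstab x hx y hy
  rw [htop] at hmem
  exact Submodule.eq_top_iff'.2 fun x ↦ hmem x trivial

end IsG₂System

end SerreG₂

section Representation

attribute [local instance] LieRing.ofAssociativeRing

/-- The images of the fourteen elements `chevalleyG₂` under the seven-dimensional representation of
the Lie algebra of type `G₂`. -/
def matrixG₂ : Fin 14 → Matrix (Fin 7) (Fin 7) ℤ :=
  ![
    !![0, 1, 0, 0, 0, 0, 0;
      0, 0, 0, 0, 0, 0, 0;
      0, 0, 0, 2, 0, 0, 0;
      0, 0, 0, 0, 2, 0, 0;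
      0, 0, 0, 0, 0, 0, 0;
      0, 0, 0, 0, 0, 0, 1;
      0, 0, 0, 0, 0, 0, 0],
    !![0, 0, 0, 0, 0, 0, 0;
      0, 0, 1, 0, 0, 0, 0;
      0, 0, 0, 0, 0, 0, 0;
      0, 0, 0, 0, 0, 0, 0;
      0, 0, 0, 0, 0, 1, 0;
      0, 0, 0, 0, 0, 0, 0;
      0, 0, 0, 0, 0, 0, 0],
    !![0, 0, 1, 0, 0, 0, 0;
      0, 0, 0, -2, 0, 0, 0;
      0, 0, 0, 0, 0, 0, 0;
      0, 0, 0, 0, 0, 2, 0;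
      0, 0, 0, 0, 0, 0, -1;
      0, 0, 0, 0, 0, 0, 0;
      0, 0, 0, 0, 0, 0, 0],
    !![0, 0, 0, -4, 0, 0, 0;
      0, 0, 0, 0, 4, 0, 0;
      0, 0, 0, 0, 0, 4, 0;
      0, 0, 0, 0, 0, 0, -4;
      0, 0, 0, 0, 0, 0, 0;
      0, 0, 0, 0, 0, 0, 0;
      0, 0, 0, 0, 0, 0, 0],
    !![0, 0, 0, 0, 12, 0, 0;
      0, 0, 0, 0, 0, 0, 0;
      0, 0, 0, 0, 0, 0, -12;
      0, 0, 0, 0, 0, 0, 0;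
      0, 0, 0, 0, 0, 0, 0;
      0, 0, 0, 0, 0, 0, 0;
      0, 0, 0, 0, 0, 0, 0],
    !![0, 0, 0, 0, 0, -12, 0;
      0, 0, 0, 0, 0, 0, -12;
      0, 0, 0, 0, 0, 0, 0;
      0, 0, 0, 0, 0, 0, 0;
      0, 0, 0, 0, 0, 0, 0;
      0, 0, 0, 0, 0, 0, 0;
      0, 0, 0, 0, 0, 0, 0],
    !![0, 0, 0, 0, 0, 0, 0;
      1, 0, 0, 0, 0, 0, 0;
      0, 0, 0, 0, 0, 0, 0;
      0, 0, 1, 0, 0, 0, 0;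
      0, 0, 0, 1, 0, 0, 0;
      0, 0, 0, 0, 0, 0, 0;
      0, 0, 0, 0, 0, 1, 0],
    !![0, 0, 0, 0, 0, 0, 0;
      0, 0, 0, 0, 0, 0, 0;
      0, 1, 0, 0, 0, 0, 0;
      0, 0, 0, 0, 0, 0, 0;
      0, 0, 0, 0, 0, 0, 0;
      0, 0, 0, 0, 1, 0, 0;
      0, 0, 0, 0, 0, 0, 0],
    !![0, 0, 0, 0, 0, 0, 0;
      0, 0, 0, 0, 0, 0, 0;
      -1, 0, 0, 0, 0, 0, 0;
      0, 1, 0, 0, 0, 0, 0;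
      0, 0, 0, 0, 0, 0, 0;
      0, 0, 0, -1, 0, 0, 0;
      0, 0, 0, 0, 1, 0, 0],
    !![0, 0, 0, 0, 0, 0, 0;
      0, 0, 0, 0, 0, 0, 0;
      0, 0, 0, 0, 0, 0, 0;
      -2, 0, 0, 0, 0, 0, 0;
      0, 1, 0, 0, 0, 0, 0;
      0, 0, 1, 0, 0, 0, 0;
      0, 0, 0, -2, 0, 0, 0],
    !![0, 0, 0, 0, 0, 0, 0;
      0, 0, 0, 0, 0, 0, 0;
      0, 0, 0, 0, 0, 0, 0;
      0, 0, 0, 0, 0, 0, 0;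
      -3, 0, 0, 0, 0, 0, 0;
      0, 0, 0, 0, 0, 0, 0;
      0, 0, 3, 0, 0, 0, 0],
    !![0, 0, 0, 0, 0, 0, 0;
      0, 0, 0, 0, 0, 0, 0;
      0, 0, 0, 0, 0, 0, 0;
      0, 0, 0, 0, 0, 0, 0;
      0, 0, 0, 0, 0, 0, 0;
      -3, 0, 0, 0, 0, 0, 0;
      0, -3, 0, 0, 0, 0, 0],
    !![1, 0, 0, 0, 0, 0, 0;
      0, -1, 0, 0, 0, 0, 0;
      0, 0, 2, 0, 0, 0, 0;
      0, 0, 0, 0, 0, 0, 0;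
      0, 0, 0, 0, -2, 0, 0;
      0, 0, 0, 0, 0, 1, 0;
      0, 0, 0, 0, 0, 0, -1],
    !![0, 0, 0, 0, 0, 0, 0;
      0, 1, 0, 0, 0, 0, 0;
      0, 0, -1, 0, 0, 0, 0;
      0, 0, 0, 0, 0, 0, 0;
      0, 0, 0, 0, 1, 0, 0;
      0, 0, 0, 0, 0, -1, 0;
      0, 0, 0, 0, 0, 0, 0]]

/-- The matrix of a symmetric bilinear form invariant under the matrices `matrixG₂`. -/
def formG₂ : Matrix (Fin 7) (Fin 7) ℤ :=
  !![0, 0, 0, 0, 0, 0, 1; 0, 0, 0, 0, 0, -1, 0; 0, 0, 0, 0, 1, 0, 0; 0, 0, 0, -1, 0, 0, 0;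
    0, 0, 1, 0, 0, 0, 0; 0, -1, 0, 0, 0, 0, 0; 1, 0, 0, 0, 0, 0, 0]

lemma chevalleyG₂_matrixG₂ :
    chevalleyG₂ (matrixG₂ 0) (matrixG₂ 1) (matrixG₂ 12) (matrixG₂ 13) (matrixG₂ 6) (matrixG₂ 7) =
      matrixG₂ := by
  have h2 : ⁅matrixG₂ 0, matrixG₂ 1⁆ = matrixG₂ 2 := by rw [Ring.lie_def]; decide +kernel
  have h3 : ⁅matrixG₂ 0, matrixG₂ 2⁆ = matrixG₂ 3 := by rw [Ring.lie_def]; decide +kernel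
  have h4 : ⁅matrixG₂ 0, matrixG₂ 3⁆ = matrixG₂ 4 := by rw [Ring.lie_def]; decide +kernel
  have h5 : ⁅matrixG₂ 1, matrixG₂ 4⁆ = matrixG₂ 5 := by rw [Ring.lie_def]; decide +kernel
  have h8 : ⁅matrixG₂ 6, matrixG₂ 7⁆ = matrixG₂ 8 := by rw [Ring.lie_def]; decide +kernel
  have h9 : ⁅matrixG₂ 6, matrixG₂ 8⁆ = matrixG₂ 9 := by rw [Ring.lie_def]; decide +kernel
  have h10 : ⁅matrixG₂ 6, matrixG₂ 9⁆ = matrixG₂ 10 := by rw [Ring.lie_def]; decide +kernel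
  have h11 : ⁅matrixG₂ 7, matrixG₂ 10⁆ = matrixG₂ 11 := by rw [Ring.lie_def]; decide +kernel
  simp only [chevalleyG₂, h2, h3, h4, h5, h8, h9, h10, h11]
  ext i : 1
  fin_cases i <;> rfl

lemma isG₂System_matrixG₂ : IsG₂System (matrixG₂ 0) (matrixG₂ 1) (matrixG₂ 12) (matrixG₂ 13)
    (matrixG₂ 6) (matrixG₂ 7) where
  lie_a_p := by rw [Ring.lie_def]; decide +kernel
  lie_b_q := by rw [Ring.lie_def]; decide +kernel
  lie_a_q := by rw [Ring.lie_def]; decide +kernel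
  lie_b_p := by rw [Ring.lie_def]; decide +kernel
  lie_u_a := by rw [Ring.lie_def]; decide +kernel
  lie_u_b := by rw [Ring.lie_def]; decide +kernel
  lie_v_a := by rw [Ring.lie_def]; decide +kernel
  lie_v_b := by rw [Ring.lie_def]; decide +kernel
  lie_u_p := by rw [Ring.lie_def]; decide +kernel
  lie_u_q := by rw [Ring.lie_def]; decide +kernel
  lie_v_p := by rw [Ring.lie_def]; decide +kernel
  lie_v_q := by rw [Ring.lie_def]; decide +kernel
  serre_a := by
    rw [show ⁅matrixG₂ 0, ⁅matrixG₂ 0, ⁅matrixG₂ 0, matrixG₂ 1⁆⁆⁆ = matrixG₂ 4 from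
      congrFun chevalleyG₂_matrixG₂ 4, Ring.lie_def]
    decide +kernel
  serre_b := by
    rw [← lie_skew (matrixG₂ 1) (matrixG₂ 0), lie_neg,
      show ⁅matrixG₂ 0, matrixG₂ 1⁆ = matrixG₂ 2 from congrFun chevalleyG₂_matrixG₂ 2, Ring.lie_def]
    decide +kernel
  serre_p := by
    rw [show ⁅matrixG₂ 6, ⁅matrixG₂ 6, ⁅matrixG₂ 6, matrixG₂ 7⁆⁆⁆ = matrixG₂ 10 from
      congrFun chevalleyG₂_matrixG₂ 10, Ring.lie_def]
    decide +kernel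
  serre_q := by
    rw [← lie_skew (matrixG₂ 7) (matrixG₂ 6), lie_neg,
      show ⁅matrixG₂ 6, matrixG₂ 7⁆ = matrixG₂ 8 from congrFun chevalleyG₂_matrixG₂ 8, Ring.lie_def]
    decide +kernel

open scoped Matrix in
lemma transpose_matrixG₂_mul_formG₂ (i : Fin 14) :
    (matrixG₂ i)ᵀ * formG₂ = -(formG₂ * matrixG₂ i) := by
  revert i; decide +kernel

end Representation

section Serre

open CartanMatrix

namespace Matrix.ToLieAlgebra

variable (R : Type*) {B : Type*} [CommRing R] [DecidableEq B] (CM : Matrix B B ℤ)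

/-- The projection from the free Lie algebra onto the Lie algebra of a Cartan matrix. -/
noncomputable def mk : FreeLieAlgebra R (Generators B) →ₗ⁅R⁆ CM.ToLieAlgebra R where
  toFun z := (LieSubmodule.Quotient.mk z : _ ⧸ Relations.toIdeal R CM)
  map_add' _ _ := rfl
  map_smul' _ _ := rfl
  map_lie' := rfl

lemma mk_surjective : Function.Surjective (mk R CM) :=
  LieSubmodule.Quotient.surjective_mk' (Relations.toIdeal R CM)

lemma mk_eq_zero_iff (z : FreeLieAlgebra R (Generators B)) :
    mk R CM z = 0 ↔ z ∈ Relations.toIdeal R CM :=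
  LieSubmodule.Quotient.mk_eq_zero'

lemma mk_eq_zero_of_mem_toSet {z : FreeLieAlgebra R (Generators B)}
    (hz : z ∈ Relations.toSet R CM) : mk R CM z = 0 :=
  (mk_eq_zero_iff R CM z).2 (LieSubmodule.subset_lieSpan hz)

variable {R CM} in
/-- A homomorphism from the free Lie algebra killing the Serre relations descends to the Lie algebra
of a Cartan matrix. -/
lemma exists_lieHom_comp_mk_eq {L : Type*} [LieRing L] [LieAlgebra R L]
    (φ : FreeLieAlgebra R (Generators B) →ₗ⁅R⁆ L) (hφ : ∀ z ∈ Relations.toSet R CM, φ z = 0) :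
    ∃ ψ : CM.ToLieAlgebra R →ₗ⁅R⁆ L, ∀ z, ψ (mk R CM z) = φ z := by
  have hker (z) (hz : mk R CM z = 0) : φ z = 0 := by
    have : Relations.toIdeal R CM ≤ φ.ker :=
      LieSubmodule.lieSpan_le.2 fun z hz ↦ LieHom.mem_ker.2 (hφ z hz)
    exact LieHom.mem_ker.1 (this ((mk_eq_zero_iff R CM z).1 hz))
  have heq (y z) (h : mk R CM y = mk R CM z) : φ y = φ z := by
    rw [← sub_eq_zero, ← map_sub]
    exact hker _ (by rw [map_sub, h, sub_self])
  choose s hs using mk_surjective R CM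
  refine ⟨{ toFun := fun x ↦ φ (s x), map_add' := ?_, map_smul' := ?_, map_lie' := ?_ }, ?_⟩
  · intro x y
    rw [← map_add]
    exact heq _ _ (by simp [hs])
  · intro c x
    rw [RingHom.id_apply, ← map_smul]
    exact heq _ _ (by simp [hs])
  · intro x y
    rw [← LieHom.map_lie]
    exact heq _ _ (by simp [hs])
  · intro z
    exact heq _ _ (hs _)

/-- The Serre generators of the Lie algebra of a Cartan matrix. -/
noncomputable def gen (g : Generators B) : CM.ToLieAlgebra R := mk R CM (FreeLieAlgebra.of R g)

lemma lie_gen_E_F_self (i : B) : ⁅gen R CM (.E i), gen R CM (.F i)⁆ = gen R CM (.H i) := by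
  have := mk_eq_zero_of_mem_toSet R CM (.inl <| .inl <| .inl <| .inl <| .inr ⟨(i, i), rfl⟩)
  simpa [gen, Relations.EF, sub_eq_zero] using this

lemma lie_gen_E_F_of_ne {i j : B} (hij : i ≠ j) : ⁅gen R CM (.E i), gen R CM (.F j)⁆ = 0 := by
  have := mk_eq_zero_of_mem_toSet R CM (.inl <| .inl <| .inl <| .inl <| .inr ⟨(i, j), rfl⟩)
  simpa [gen, Relations.EF, hij] using this

lemma lie_gen_H_E (i j : B) : ⁅gen R CM (.H i), gen R CM (.E j)⁆ = CM i j • gen R CM (.E j) := by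
  have := mk_eq_zero_of_mem_toSet R CM (.inl <| .inl <| .inl <| .inr ⟨(i, j), rfl⟩)
  simpa [gen, Relations.HE, sub_eq_zero] using this

lemma lie_gen_H_F (i j : B) :
    ⁅gen R CM (.H i), gen R CM (.F j)⁆ = (-CM i j) • gen R CM (.F j) := by
  have := mk_eq_zero_of_mem_toSet R CM (.inl <| .inl <| .inr ⟨(i, j), rfl⟩)
  rw [neg_smul, eq_neg_iff_add_eq_zero]
  simpa [gen, Relations.HF] using this

variable {CM} in
lemma mk_ad_pow (x y : FreeLieAlgebra R (Generators B)) (n : ℕ) :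
    mk R CM ((LieAlgebra.ad R _ x ^ n) y) = (LieAlgebra.ad R _ (mk R CM x) ^ n) (mk R CM y) := by
  induction n with
  | zero => simp
  | succ n ih => simp [pow_succ', ih]

lemma ad_pow_lie_gen_E (i j : B) :
    (LieAlgebra.ad R _ (gen R CM (.E i)) ^ (-CM i j).toNat) ⁅gen R CM (.E i), gen R CM (.E j)⁆ =
      0 := by
  have := mk_eq_zero_of_mem_toSet R CM (.inl <| .inr ⟨(i, j), rfl⟩)
  simpa [gen, Relations.adE, mk_ad_pow] using this

lemma ad_pow_lie_gen_F (i j : B) :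
    (LieAlgebra.ad R _ (gen R CM (.F i)) ^ (-CM i j).toNat) ⁅gen R CM (.F i), gen R CM (.F j)⁆ =
      0 := by
  have := mk_eq_zero_of_mem_toSet R CM (.inr ⟨(i, j), rfl⟩)
  simpa [gen, Relations.adF, mk_ad_pow] using this

lemma lieSpan_range_gen_eq_top :
    LieSubalgebra.lieSpan R (CM.ToLieAlgebra R) (Set.range (gen R CM)) = ⊤ := by
  set T := LieSubalgebra.lieSpan R (CM.ToLieAlgebra R) (Set.range (gen R CM))
  let φ : FreeLieAlgebra R (Generators B) →ₗ⁅R⁆ T :=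
    FreeLieAlgebra.lift R fun g ↦ ⟨gen R CM g,
      LieSubalgebra.subset_lieSpan ⟨g, rfl⟩⟩
  have hφ : T.incl.comp φ = mk R CM := by
    ext g
    simp [φ, gen]
  rw [eq_top_iff]
  rintro x -
  obtain ⟨z, rfl⟩ := mk_surjective R CM x
  rw [← hφ]
  exact (φ z).2

end Matrix.ToLieAlgebra

end Serre

section G₂Generators

open CartanMatrix Matrix.ToLieAlgebra

lemma isG₂System_gen :
    IsG₂System (gen ℂ CartanMatrix.G₂ (.E 0)) (gen ℂ CartanMatrix.G₂ (.E 1))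
      (gen ℂ CartanMatrix.G₂ (.H 0)) (gen ℂ CartanMatrix.G₂ (.H 1))
      (gen ℂ CartanMatrix.G₂ (.F 0)) (gen ℂ CartanMatrix.G₂ (.F 1)) where
  lie_a_p := lie_gen_E_F_self ..
  lie_b_q := lie_gen_E_F_self ..
  lie_a_q := lie_gen_E_F_of_ne _ _ (by decide)
  lie_b_p := lie_gen_E_F_of_ne _ _ (by decide)
  lie_u_a := lie_gen_H_E ..
  lie_u_b := lie_gen_H_E ..
  lie_v_a := lie_gen_H_E ..
  lie_v_b := lie_gen_H_E ..
  lie_u_p := lie_gen_H_F ..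
  lie_u_q := lie_gen_H_F ..
  lie_v_p := lie_gen_H_F ..
  lie_v_q := lie_gen_H_F ..
  serre_a := ad_pow_lie_gen_E ℂ CartanMatrix.G₂ 0 1
  serre_b := ad_pow_lie_gen_E ℂ CartanMatrix.G₂ 1 0
  serre_p := ad_pow_lie_gen_F ℂ CartanMatrix.G₂ 0 1
  serre_q := ad_pow_lie_gen_F ℂ CartanMatrix.G₂ 1 0

lemma lieSpan_gen_eq_top : LieSubalgebra.lieSpan ℂ (LieAlgebra.g₂ ℂ)
    {gen ℂ CartanMatrix.G₂ (.E 0), gen ℂ CartanMatrix.G₂ (.E 1), gen ℂ CartanMatrix.G₂ (.F 0),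
      gen ℂ CartanMatrix.G₂ (.F 1)} = ⊤ := by
  rw [eq_top_iff, ← lieSpan_range_gen_eq_top, LieSubalgebra.lieSpan_le]
  have hE (i) : gen ℂ CartanMatrix.G₂ (.E i) ∈ LieSubalgebra.lieSpan ℂ (LieAlgebra.g₂ ℂ)
    {gen ℂ CartanMatrix.G₂ (.E 0), gen ℂ CartanMatrix.G₂ (.E 1), gen ℂ CartanMatrix.G₂ (.F 0),
      gen ℂ CartanMatrix.G₂ (.F 1)} :=
    LieSubalgebra.subset_lieSpan (by fin_cases i <;> simp)
  have hF (i) : gen ℂ CartanMatrix.G₂ (.F i) ∈ LieSubalgebra.lieSpan ℂ (LieAlgebra.g₂ ℂ)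
    {gen ℂ CartanMatrix.G₂ (.E 0), gen ℂ CartanMatrix.G₂ (.E 1), gen ℂ CartanMatrix.G₂ (.F 0),
      gen ℂ CartanMatrix.G₂ (.F 1)} :=
    LieSubalgebra.subset_lieSpan (by fin_cases i <;> simp)
  rintro _ ⟨i | i | i, rfl⟩
  · rw [← lie_gen_E_F_self]
    exact LieSubalgebra.lie_mem _ (hE i) (hF i)
  · exact hE i
  · exact hF i

end G₂Generators

section Faithful

open CartanMatrix Matrix.ToLieAlgebra

lemma IsG₂System.exists_lieHom {L : Type*} [LieRing L] [LieAlgebra ℂ L] {a b u v p q : L}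
    (H : IsG₂System a b u v p q) : ∃ ψ : LieAlgebra.g₂ ℂ →ₗ⁅ℂ⁆ L,
      ψ (gen ℂ CartanMatrix.G₂ (.E 0)) = a ∧ ψ (gen ℂ CartanMatrix.G₂ (.E 1)) = b ∧
      ψ (gen ℂ CartanMatrix.G₂ (.H 0)) = u ∧ ψ (gen ℂ CartanMatrix.G₂ (.H 1)) = v ∧
      ψ (gen ℂ CartanMatrix.G₂ (.F 0)) = p ∧ ψ (gen ℂ CartanMatrix.G₂ (.F 1)) = q := by
  have hvu : ⁅v, u⁆ = 0 := by rw [← lie_skew, H.lie_u_v, neg_zero]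
  let φ : FreeLieAlgebra ℂ (Generators (Fin 2)) →ₗ⁅ℂ⁆ L := FreeLieAlgebra.lift ℂ fun
    | .E i => ![a, b] i
    | .H i => ![u, v] i
    | .F i => ![p, q] i
  have hE (i) : φ (.of ℂ (.E i)) = ![a, b] i := FreeLieAlgebra.lift_of_apply ..
  have hH (i) : φ (.of ℂ (.H i)) = ![u, v] i := FreeLieAlgebra.lift_of_apply ..
  have hF (i) : φ (.of ℂ (.F i)) = ![p, q] i := FreeLieAlgebra.lift_of_apply ..
  obtain ⟨ψ, hψ⟩ := exists_lieHom_comp_mk_eq (CM := CartanMatrix.G₂) φ (by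
    rintro _ (((((⟨⟨i, j⟩, rfl⟩ | ⟨⟨i, j⟩, rfl⟩) | ⟨⟨i, j⟩, rfl⟩) | ⟨⟨i, j⟩, rfl⟩) |
      ⟨⟨i, j⟩, rfl⟩) | ⟨⟨i, j⟩, rfl⟩)
    · fin_cases i <;> fin_cases j <;> simp [Relations.HH, hH, H.lie_u_v, hvu]
    · fin_cases i <;> fin_cases j <;>
        simp [Relations.EF, hE, hF, hH, H.lie_a_p, H.lie_a_q, H.lie_b_p, H.lie_b_q]
    · fin_cases i <;> fin_cases j <;>
        simp [Relations.HE, hE, hH, H.lie_u_a, H.lie_u_b, H.lie_v_a, H.lie_v_b, CartanMatrix.G₂]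
    · fin_cases i <;> fin_cases j <;>
        simp [Relations.HF, hF, hH, H.lie_u_p, H.lie_u_q, H.lie_v_p, H.lie_v_q, CartanMatrix.G₂]
    · fin_cases i <;> fin_cases j <;>
        simp [Relations.adE, hE, pow_succ', H.serre_a, H.serre_b, CartanMatrix.G₂]
    · fin_cases i <;> fin_cases j <;>
        simp [Relations.adF, hF, pow_succ', H.serre_p, H.serre_q, CartanMatrix.G₂])
  exact ⟨ψ, (hψ _).trans (hE 0), (hψ _).trans (hE 1), (hψ _).trans (hH 0), (hψ _).trans (hH 1),
    (hψ _).trans (hF 0), (hψ _).trans (hF 1)⟩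

attribute [local instance] LieRing.ofAssociativeRing

open scoped Matrix

lemma exists_injective_matrix_representation :
    ∃ ρ : LieAlgebra.g₂ ℂ →ₗ[ℂ] Matrix (Fin 7) (Fin 7) ℂ,
      (∀ x y, ρ ⁅x, y⁆ = ρ x * ρ y - ρ y * ρ x) ∧
      (∀ x, (ρ x)ᵀ * formG₂.map (Int.cast : ℤ → ℂ) = -(formG₂.map (Int.cast : ℤ → ℂ) * ρ x)) ∧
      Function.Injective ρ := by
  let c : Matrix (Fin 7) (Fin 7) ℤ →+* Matrix (Fin 7) (Fin 7) ℂ := (Int.castRingHom ℂ).mapMatrix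
  have hc (x y) : c ⁅x, y⁆ = ⁅c x, c y⁆ := by simp [Ring.lie_def]
  obtain ⟨ψ, hE0, hE1, hH0, hH1, hF0, hF1⟩ :=
    (isG₂System_matrixG₂.map (c : _ →+ Matrix (Fin 7) (Fin 7) ℂ) hc).exists_lieHom
  let w := chevalleyG₂ (gen ℂ CartanMatrix.G₂ (.E 0)) (gen ℂ CartanMatrix.G₂ (.E 1))
    (gen ℂ CartanMatrix.G₂ (.H 0)) (gen ℂ CartanMatrix.G₂ (.H 1))
    (gen ℂ CartanMatrix.G₂ (.F 0)) (gen ℂ CartanMatrix.G₂ (.F 1))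
  have hψ (i) : ψ (w i) = c (matrixG₂ i) := by
    rw [← congrFun chevalleyG₂_matrixG₂ i, map_chevalleyG₂ c hc, map_chevalleyG₂ ψ ψ.map_lie,
      hE0, hE1, hH0, hH1, hF0, hF1]
    rfl
  have hw : Submodule.span ℂ (Set.range w) = ⊤ :=
    isG₂System_gen.span_chevalleyG₂_eq_top lieSpan_gen_eq_top
  refine ⟨ψ, ψ.map_lie, fun x ↦ ?_, ?_⟩
  · have hx : x ∈ Submodule.span ℂ (Set.range w) := hw ▸ Submodule.mem_top
    induction hx using Submodule.span_induction with
    | mem x hx =>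
      obtain ⟨i, rfl⟩ := hx
      have := congrArg c (transpose_matrixG₂_mul_formG₂ i)
      rw [map_mul, map_neg, map_mul] at this
      change (ψ _)ᵀ * _ = -(_ * ψ _)
      rw [hψ]
      exact this
    | zero => simp
    | add x y _ _ hx hy => rw [map_add, Matrix.transpose_add, add_mul, hx, hy, mul_add, neg_add]
    | smul r x _ hx =>
      rw [map_smul, Matrix.transpose_smul, smul_mul_assoc, hx, mul_smul_comm, smul_neg]
  · rw [injective_iff_map_eq_zero]
    intro x hx
    obtain ⟨r, rfl⟩ := (Submodule.mem_span_range_iff_exists_fun ℂ).1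
      (hw ▸ Submodule.mem_top : x ∈ Submodule.span ℂ (Set.range w))
    change ψ _ = 0 at hx
    simp only [map_sum, map_smul, hψ] at hx
    have hentry (j k : Fin 7) : ∑ i, r i * (matrixG₂ i j k : ℂ) = 0 := by
      simpa [Matrix.sum_apply, c] using congrFun (congrFun hx j) k
    have h0 := hentry 0 1
    have h1 := hentry 1 2
    have h2 := hentry 0 2
    have h3 := hentry 0 3
    have h4 := hentry 0 4
    have h5 := hentry 0 5
    have h6 := hentry 1 0
    have h7 := hentry 2 1
    have h8 := hentry 2 0
    have h9 := hentry 3 0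
    have h10 := hentry 4 0
    have h11 := hentry 5 0
    have h12 := hentry 0 0
    have h13 := hentry 1 1
    simp [Fin.sum_univ_succ, matrixG₂] at h0 h1 h2 h3 h4 h5 h6 h7 h8 h9 h10 h11 h12 h13
    have hr : r = 0 := by
      ext i
      fin_cases i <;> simp_all
    simp [hr]

/-- The Lie algebra of type `G₂` has a faithful seven-dimensional orthogonal representation. -/
theorem exists_faithful_orthogonal_representation :
    ∃ (ρ : LieAlgebra.g₂ ℂ →ₗ[ℂ] Module.End ℂ (Fin 7 → ℂ))
      (B : LinearMap.BilinForm ℂ (Fin 7 → ℂ)),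
      (∀ x y, ρ ⁅x, y⁆ = ρ x * ρ y - ρ y * ρ x) ∧ Function.Injective ρ ∧
      B.Nondegenerate ∧ (∀ x y, B x y = B y x) ∧ ∀ z x y, B (ρ z x) y = -B x (ρ z y) := by
  obtain ⟨ρ, hρ, hskew, hinj⟩ := exists_injective_matrix_representation
  set J : Matrix (Fin 7) (Fin 7) ℂ := formG₂.map (Int.cast : ℤ → ℂ) with hJ
  have hJJ : J * J = 1 := by
    rw [hJ, ← Matrix.map_mul_intCast, show formG₂ * formG₂ = 1 by decide +kernel]
    simp
  have hJt : Jᵀ = J := by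
    rw [hJ, ← Matrix.transpose_map, show formG₂ᵀ = formG₂ by decide +kernel]
  have hdet : J.det ≠ 0 := fun h ↦ by simpa [h] using congrArg Matrix.det hJJ
  refine ⟨Matrix.toLinAlgEquiv'.toLinearMap ∘ₗ ρ, Matrix.toBilin' J, fun x y ↦ ?_, ?_,
    LinearMap.BilinForm.nondegenerate_toBilin'_of_det_ne_zero' J hdet, fun x y ↦ ?_,
    fun z x y ↦ ?_⟩
  · simp [hρ]
  · exact Matrix.toLinAlgEquiv'.injective.comp hinj
  · rw [Matrix.toBilin'_apply', Matrix.toBilin'_apply', Matrix.dotProduct_mulVec, dotProduct_comm,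
      ← Matrix.mulVec_transpose, hJt]
  · simp only [LinearMap.comp_apply, Matrix.toBilin'_apply']
    change (ρ z *ᵥ x) ⬝ᵥ (J *ᵥ y) = -(x ⬝ᵥ J *ᵥ (ρ z *ᵥ y))
    rw [Matrix.mulVec_mulVec, ← dotProduct_neg, ← Matrix.neg_mulVec, ← hskew,
      ← Matrix.mulVec_mulVec, Matrix.dotProduct_mulVec x, Matrix.vecMul_transpose]

end Faithful

lemma exists_lie_lie_eq_smul_of_mem_derived {h e : LieAlgebra.g₂ ℂ} (hhe : ⁅h, e⁆ = (2 : ℂ) • e)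
    (he : e ∈ derived e) (x : LieAlgebra.g₂ ℂ) : ∃ c : ℂ, ⁅e, ⁅e, x⁆⁆ = c • e := by
  obtain ⟨ρ, B, hρ, hinj, hB, hS, hskew⟩ := exists_faithful_orthogonal_representation
  have hV : Module.finrank ℂ (Fin 7 → ℂ) < 8 := by simp
  have hcomm (y) (hy : y ∈ centralizer e) : Commute (ρ e) (ρ y) := by
    have hy' : ⁅e, y⁆ = 0 := hy
    rw [commute_iff_eq, ← sub_eq_zero, ← hρ, hy', map_zero]
  have hnil : IsNilpotent (ρ e) := by
    refine isNilpotent_of_commutator_eq_two_mul (H := ρ h) ?_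
    rw [← hρ, hhe, map_smul, two_smul, two_mul]
  have hder : derived e ≤ (commutantDerived (ρ e)).comap ρ := by
    refine Submodule.span_le.2 ?_
    rintro _ ⟨y, hy, z, hz, rfl⟩
    exact Submodule.subset_span ⟨ρ y, ρ z, hcomm y hy, hcomm z hz, (hρ y z).symm⟩
  have h2 := sq_eq_zero_of_mem_commutantDerived hV hB hS (hskew e) hnil (hder he)
  obtain ⟨c, hc⟩ := exists_mul_mul_eq_smul hV hB hS (hskew e) (hskew x) h2
  refine ⟨-2 * c, hinj ?_⟩
  rw [pow_two] at h2
  rw [hρ, hρ, mul_sub, sub_mul, ← mul_assoc, h2, mul_assoc (ρ x), h2, zero_mul, mul_zero,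
    ← mul_assoc, hc, map_smul]
  module

/-- Panyushev property for the simple Lie algebra of type G2:
`e` is reachable iff the Lie subalgebra generated by `g(1)_e` contains every `g(k)_e`, `k ≥ 1`. -/
theorem panyushev_property_G2 (h e f : LieAlgebra.g₂ ℂ)
    (hhe : ⁅h, e⁆ = (2 : ℂ) • e) (hhf : ⁅h, f⁆ = (-2 : ℂ) • f) (hef : ⁅e, f⁆ = h) :
    e ∈ derived e ↔
      ∀ k : ℤ, 1 ≤ k → ∀ x : LieAlgebra.g₂ ℂ, ⁅e, x⁆ = 0 → ⁅h, x⁆ = (k : ℂ) • x →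
        x ∈ LieSubalgebra.lieSpan ℂ (LieAlgebra.g₂ ℂ)
            {x : LieAlgebra.g₂ ℂ | ⁅e, x⁆ = 0 ∧ ⁅h, x⁆ = x} := by
  have hder : derived e = Submodule.span ℂ
      {z : LieAlgebra.g₂ ℂ | ∃ x y : LieAlgebra.g₂ ℂ, ⁅e, x⁆ = 0 ∧ ⁅e, y⁆ = 0 ∧ ⁅x, y⁆ = z} := by
    refine congrArg (Submodule.span ℂ) (Set.ext fun z ↦ ?_)
    exact ⟨fun ⟨x, hx, y, hy, hxy⟩ ↦ ⟨x, y, hx, hy, hxy⟩,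
      fun ⟨x, y, hx, hy, hxy⟩ ↦ ⟨x, hx, y, hy, hxy⟩⟩
  constructor
  · intro he k hk x hx hhx
    exact mem_lieSpan_of_lie_eq_smul hhf hhe hef (exists_lie_lie_eq_smul_of_mem_derived hhe he)
      (hder ▸ he) hk hx hhx
  · intro H
    rw [hder]
    exact mem_span_lie_of_mem_lieSpan hhe
      (H 2 one_le_two e (lie_self e) (by rw [hhe, Int.cast_ofNat]))
end

section
/- Let g be the finite-dimensional simple Lie algebra of type G₂ over ℂ (so dim g = 14). For every nonzero nilpotent element e of g, one has e ∈ [g_e,g_e] if and only if dim g_e = 8; moreover, if dim g_e = 8 then in fact g_e = [g_e,g_e]. -/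
/-- Coordinates, with respect to a Chevalley basis, on the Lie algebra of type `G₂`. The
coordinates `0, …, 5` belong to the positive roots `α, β, α + β, 2α + β, 3α + β, 3α + 2β` (with `α`
short), `6, 7` to the simple coroots, and `8, …, 13` to the corresponding negative roots. -/
def ChevalleyG2 : Type := Fin 14 → ℂ

namespace ChevalleyG2

noncomputable instance : AddCommGroup ChevalleyG2 := inferInstanceAs (AddCommGroup (Fin 14 → ℂ))
noncomputable instance : Module ℂ ChevalleyG2 := inferInstanceAs (Module ℂ (Fin 14 → ℂ))
instance : Module.Finite ℂ ChevalleyG2 := inferInstanceAs (Module.Finite ℂ (Fin 14 → ℂ))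

@[ext] theorem ext {a b : ChevalleyG2} (h : ∀ i, a i = b i) : a = b := funext h

@[simp] theorem add_apply (a b : ChevalleyG2) (i : Fin 14) : (a + b) i = a i + b i := rfl
@[simp] theorem neg_apply (a : ChevalleyG2) (i : Fin 14) : (-a) i = -a i := rfl
@[simp] theorem sub_apply (a b : ChevalleyG2) (i : Fin 14) : (a - b) i = a i - b i := rfl
@[simp] theorem smul_apply (c : ℂ) (a : ChevalleyG2) (i : Fin 14) : (c • a) i = c * a i := rfl
@[simp] theorem zero_apply (i : Fin 14) : (0 : ChevalleyG2) i = 0 := rfl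

/-- The matrix of an element in the `7`-dimensional representation. -/
def rep (a : ChevalleyG2) : Matrix (Fin 7) (Fin 7) ℂ :=
  !![a 6, a 0, a 2, -2 * a 3, a 4, -a 5, 0;
    a 8, -a 6 + a 7, a 1, -2 * a 2, a 3, 0, -a 5;
    -a 10, a 9, 2 * a 6 - a 7, 2 * a 0, 0, a 3, -a 4;
    -a 11, a 10, a 8, 0, a 0, a 2, -a 3;
    -a 12, a 11, 0, 2 * a 8, -2 * a 6 + a 7, a 1, -a 2;
    -a 13, 0, a 11, -2 * a 10, a 9, a 6 - a 7, a 0;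
    0, -a 13, a 12, -2 * a 11, a 10, a 8, -a 6]

/-- The Lie bracket in coordinates. -/
def br (a b : ChevalleyG2) : ChevalleyG2 :=
  ![-2 * (a 0 * b 6 - a 6 * b 0) + (a 0 * b 7 - a 7 * b 0) + (a 2 * b 9 - a 9 * b 2) - 2 * (a 3 * b 10 - a 10 * b 3) + (a 4 * b 11 - a 11 * b 4),
    3 * (a 1 * b 6 - a 6 * b 1) - 2 * (a 1 * b 7 - a 7 * b 1) - 3 * (a 2 * b 8 - a 8 * b 2) - (a 5 * b 12 - a 12 * b 5),
    (a 0 * b 1 - a 1 * b 0) + (a 2 * b 6 - a 6 * b 2) - (a 2 * b 7 - a 7 * b 2) - 2 * (a 3 * b 8 - a 8 * b 3) - (a 5 * b 11 - a 11 * b 5),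
    2 * (a 0 * b 2 - a 2 * b 0) - (a 3 * b 6 - a 6 * b 3) - (a 4 * b 8 - a 8 * b 4) - (a 5 * b 10 - a 10 * b 5),
    3 * (a 0 * b 3 - a 3 * b 0) - 3 * (a 4 * b 6 - a 6 * b 4) + (a 4 * b 7 - a 7 * b 4) - (a 5 * b 9 - a 9 * b 5),
    (a 1 * b 4 - a 4 * b 1) - 3 * (a 2 * b 3 - a 3 * b 2) - (a 5 * b 7 - a 7 * b 5),
    (a 0 * b 8 - a 8 * b 0) - (a 2 * b 10 - a 10 * b 2) + 2 * (a 3 * b 11 - a 11 * b 3) - (a 4 * b 12 - a 12 * b 4) + (a 5 * b 13 - a 13 * b 5),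
    (a 1 * b 9 - a 9 * b 1) - 3 * (a 2 * b 10 - a 10 * b 2) + 3 * (a 3 * b 11 - a 11 * b 3) - (a 4 * b 12 - a 12 * b 4) + 2 * (a 5 * b 13 - a 13 * b 5),
    -(a 1 * b 10 - a 10 * b 1) + 2 * (a 2 * b 11 - a 11 * b 2) - (a 3 * b 12 - a 12 * b 3) - 2 * (a 6 * b 8 - a 8 * b 6) + (a 7 * b 8 - a 8 * b 7),
    3 * (a 0 * b 10 - a 10 * b 0) + (a 4 * b 13 - a 13 * b 4) + 3 * (a 6 * b 9 - a 9 * b 6) - 2 * (a 7 * b 9 - a 9 * b 7),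
    2 * (a 0 * b 11 - a 11 * b 0) + (a 3 * b 13 - a 13 * b 3) + (a 6 * b 10 - a 10 * b 6) - (a 7 * b 10 - a 10 * b 7) + (a 8 * b 9 - a 9 * b 8),
    (a 0 * b 12 - a 12 * b 0) + (a 2 * b 13 - a 13 * b 2) - (a 6 * b 11 - a 11 * b 6) + 2 * (a 8 * b 10 - a 10 * b 8),
    (a 1 * b 13 - a 13 * b 1) - 3 * (a 6 * b 12 - a 12 * b 6) + (a 7 * b 12 - a 12 * b 7) + 3 * (a 8 * b 11 - a 11 * b 8),
    -(a 7 * b 13 - a 13 * b 7) + (a 9 * b 12 - a 12 * b 9) - 3 * (a 10 * b 11 - a 11 * b 10)]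

theorem rep_injective : Function.Injective rep := by
  intro a b h
  have h' : ∀ i j, rep a i j = rep b i j := fun i j => by rw [h]
  ext i
  fin_cases i
  · simpa [rep] using h' 0 1
  · simpa [rep] using h' 1 2
  · simpa [rep] using h' 0 2
  · simpa [rep] using h' 1 4
  · simpa [rep] using h' 0 4
  · simpa [rep] using h' 0 5
  · simpa [rep] using h' 0 0
  · have h0 := h' 0 0
    have h1 := h' 1 1
    simp only [rep, Matrix.of_apply, Matrix.cons_val] at h0 h1
    simp only [Fin.reduceFinMk]
    linear_combination h0 + h1
  · simpa [rep] using h' 1 0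
  · simpa [rep] using h' 2 1
  · simpa [rep] using h' 3 1
  · simpa [rep] using h' 3 0
  · simpa [rep] using h' 4 0
  · simpa [rep] using h' 5 0

theorem rep_add (a b : ChevalleyG2) : rep (a + b) = rep a + rep b := by
  ext i j
  fin_cases i <;> fin_cases j <;> simp [rep] <;> ring

theorem rep_smul (c : ℂ) (a : ChevalleyG2) : rep (c • a) = c • rep a := by
  ext i j
  fin_cases i <;> fin_cases j <;> simp [rep] <;> ring

theorem rep_zero : rep 0 = 0 := by simpa using rep_smul 0 0

theorem rep_br (a b : ChevalleyG2) : rep (br a b) = rep a * rep b - rep b * rep a := by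
  ext i j
  fin_cases i <;> fin_cases j <;>
    simp only [rep, br, Matrix.mul_apply, Matrix.sub_apply, Fin.sum_univ_seven, Matrix.of_apply,
      Matrix.cons_val, Fin.reduceFinMk, Fin.zero_eta, Fin.mk_one, Fin.isValue] <;>
    ring

noncomputable instance : LieRing ChevalleyG2 where
  bracket := br
  add_lie a b c := rep_injective <| by
    change rep (br (a + b) c) = rep (br a c + br b c)
    simp only [rep_add, rep_br]; noncomm_ring
  lie_add a b c := rep_injective <| by
    change rep (br a (b + c)) = rep (br a b + br a c)
    simp only [rep_add, rep_br]; noncomm_ring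
  lie_self a := rep_injective <| by
    change rep (br a a) = rep 0
    rw [rep_br, rep_zero, sub_self]
  leibniz_lie a b c := rep_injective <| by
    change rep (br a (br b c)) = rep (br (br a b) c + br b (br a c))
    simp only [rep_add, rep_br]; noncomm_ring

theorem lie_def (a b : ChevalleyG2) : ⁅a, b⁆ = br a b := rfl

noncomputable instance : LieAlgebra ℂ ChevalleyG2 where
  lie_smul c a b := rep_injective <| by
    simp only [lie_def, rep_smul, rep_br, Algebra.mul_smul_comm, Algebra.smul_mul_assoc, smul_sub]

/-- The root group of `α` in the adjoint representation. -/
def adAlpha (t : ℂ) (a : ChevalleyG2) : ChevalleyG2 :=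
  ![a 0 - 2 * t * a 6 + t * a 7 - t ^ 2 * a 8,
    a 1,
    a 2 + t * a 1,
    a 3 + 2 * t * a 2 + t ^ 2 * a 1,
    a 4 + 3 * t * a 3 + 3 * t ^ 2 * a 2 + t ^ 3 * a 1,
    a 5,
    a 6 + t * a 8,
    a 7,
    a 8,
    a 9 + 3 * t * a 10 + 3 * t ^ 2 * a 11 + t ^ 3 * a 12,
    a 10 + 2 * t * a 11 + t ^ 2 * a 12,
    a 11 + t * a 12,
    a 12,
    a 13]

/-- The root group of `α` in the `7`-dimensional representation. -/
def matAlpha (t : ℂ) : Matrix (Fin 7) (Fin 7) ℂ :=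
  !![1, t, 0, 0, 0, 0, 0;
    0, 1, 0, 0, 0, 0, 0;
    0, 0, 1, 2 * t, t ^ 2, 0, 0;
    0, 0, 0, 1, t, 0, 0;
    0, 0, 0, 0, 1, 0, 0;
    0, 0, 0, 0, 0, 1, t;
    0, 0, 0, 0, 0, 0, 1]

theorem matAlpha_mul_neg (t : ℂ) : matAlpha t * matAlpha (-t) = 1 := by
  ext i j
  fin_cases i <;> fin_cases j <;>
    simp [matAlpha, Matrix.mul_apply, Fin.sum_univ_seven] <;> ring

theorem matAlpha_mul_rep (t : ℂ) (a : ChevalleyG2) :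
    matAlpha t * rep a = rep (adAlpha t a) * matAlpha t := by
  ext i j
  fin_cases i <;> fin_cases j <;>
    simp only [matAlpha, rep, adAlpha, Matrix.mul_apply, Fin.sum_univ_seven, Matrix.of_apply,
      Matrix.cons_val, Fin.reduceFinMk, Fin.zero_eta, Fin.mk_one, Fin.isValue] <;>
    ring

/-- The root group of `β` in the adjoint representation. -/
def adBeta (t : ℂ) (a : ChevalleyG2) : ChevalleyG2 :=
  ![a 0,
    a 1 + 3 * t * a 6 - 2 * t * a 7 - t ^ 2 * a 9,
    a 2 - t * a 0,
    a 3,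
    a 4,
    a 5 + t * a 4,
    a 6,
    a 7 + t * a 9,
    a 8 - t * a 10,
    a 9,
    a 10,
    a 11,
    a 12 + t * a 13,
    a 13]

/-- The root group of `β` in the `7`-dimensional representation. -/
def matBeta (t : ℂ) : Matrix (Fin 7) (Fin 7) ℂ :=
  !![1, 0, 0, 0, 0, 0, 0;
    0, 1, t, 0, 0, 0, 0;
    0, 0, 1, 0, 0, 0, 0;
    0, 0, 0, 1, 0, 0, 0;
    0, 0, 0, 0, 1, t, 0;
    0, 0, 0, 0, 0, 1, 0;
    0, 0, 0, 0, 0, 0, 1]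

theorem matBeta_mul_neg (t : ℂ) : matBeta t * matBeta (-t) = 1 := by
  ext i j
  fin_cases i <;> fin_cases j <;>
    simp [matBeta, Matrix.mul_apply, Fin.sum_univ_seven]

theorem matBeta_mul_rep (t : ℂ) (a : ChevalleyG2) :
    matBeta t * rep a = rep (adBeta t a) * matBeta t := by
  ext i j
  fin_cases i <;> fin_cases j <;>
    simp only [matBeta, rep, adBeta, Matrix.mul_apply, Fin.sum_univ_seven, Matrix.of_apply,
      Matrix.cons_val, Fin.reduceFinMk, Fin.zero_eta, Fin.mk_one, Fin.isValue] <;>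
    ring

/-- The root group of `α + β` in the adjoint representation. -/
def adAlphaBeta (t : ℂ) (a : ChevalleyG2) : ChevalleyG2 :=
  ![a 0 + t * a 9,
    a 1 - 3 * t * a 8 - 3 * t ^ 2 * a 11 - t ^ 3 * a 13,
    a 2 + t * a 6 - t * a 7 + t ^ 2 * a 10,
    a 3 - 2 * t * a 0 - t ^ 2 * a 9,
    a 4,
    a 5 - 3 * t * a 3 + 3 * t ^ 2 * a 0 + t ^ 3 * a 9,
    a 6 - t * a 10,
    a 7 - 3 * t * a 10,
    a 8 + 2 * t * a 11 + t ^ 2 * a 13,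
    a 9,
    a 10,
    a 11 + t * a 13,
    a 12,
    a 13]

/-- The root group of `α + β` in the `7`-dimensional representation. -/
def matAlphaBeta (t : ℂ) : Matrix (Fin 7) (Fin 7) ℂ :=
  !![1, 0, t, 0, 0, 0, 0;
    0, 1, 0, -2 * t, 0, -t ^ 2, 0;
    0, 0, 1, 0, 0, 0, 0;
    0, 0, 0, 1, 0, t, 0;
    0, 0, 0, 0, 1, 0, -t;
    0, 0, 0, 0, 0, 1, 0;
    0, 0, 0, 0, 0, 0, 1]

theorem matAlphaBeta_mul_neg (t : ℂ) : matAlphaBeta t * matAlphaBeta (-t) = 1 := by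
  ext i j
  fin_cases i <;> fin_cases j <;>
    simp [matAlphaBeta, Matrix.mul_apply, Fin.sum_univ_seven] <;> ring

theorem matAlphaBeta_mul_rep (t : ℂ) (a : ChevalleyG2) :
    matAlphaBeta t * rep a = rep (adAlphaBeta t a) * matAlphaBeta t := by
  ext i j
  fin_cases i <;> fin_cases j <;>
    simp only [matAlphaBeta, rep, adAlphaBeta, Matrix.mul_apply, Fin.sum_univ_seven, Matrix.of_apply,
      Matrix.cons_val, Fin.reduceFinMk, Fin.zero_eta, Fin.mk_one, Fin.isValue] <;>
    ring

/-- The root group of `2α + β` in the adjoint representation. -/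
def adAlphaAlphaBeta (t : ℂ) (a : ChevalleyG2) : ChevalleyG2 :=
  ![a 0 - 2 * t * a 10 - t ^ 2 * a 13,
    a 1,
    a 2 - 2 * t * a 8 + t ^ 2 * a 12,
    a 3 - t * a 6 - t ^ 2 * a 11,
    a 4 - 3 * t * a 0 + 3 * t ^ 2 * a 10 + t ^ 3 * a 13,
    a 5 + 3 * t * a 2 - 3 * t ^ 2 * a 8 + t ^ 3 * a 12,
    a 6 + 2 * t * a 11,
    a 7 + 3 * t * a 11,
    a 8 - t * a 12,
    a 9,
    a 10 + t * a 13,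
    a 11,
    a 12,
    a 13]

/-- The root group of `2α + β` in the `7`-dimensional representation. -/
def matAlphaAlphaBeta (t : ℂ) : Matrix (Fin 7) (Fin 7) ℂ :=
  !![1, 0, 0, -2 * t, 0, 0, t ^ 2;
    0, 1, 0, 0, t, 0, 0;
    0, 0, 1, 0, 0, t, 0;
    0, 0, 0, 1, 0, 0, -t;
    0, 0, 0, 0, 1, 0, 0;
    0, 0, 0, 0, 0, 1, 0;
    0, 0, 0, 0, 0, 0, 1]

theorem matAlphaAlphaBeta_mul_neg (t : ℂ) : matAlphaAlphaBeta t * matAlphaAlphaBeta (-t) = 1 := by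
  ext i j
  fin_cases i <;> fin_cases j <;>
    simp [matAlphaAlphaBeta, Matrix.mul_apply, Fin.sum_univ_seven] <;> ring

theorem matAlphaAlphaBeta_mul_rep (t : ℂ) (a : ChevalleyG2) :
    matAlphaAlphaBeta t * rep a = rep (adAlphaAlphaBeta t a) * matAlphaAlphaBeta t := by
  ext i j
  fin_cases i <;> fin_cases j <;>
    simp only [matAlphaAlphaBeta, rep, adAlphaAlphaBeta, Matrix.mul_apply, Fin.sum_univ_seven, Matrix.of_apply,
      Matrix.cons_val, Fin.reduceFinMk, Fin.zero_eta, Fin.mk_one, Fin.isValue] <;>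
    ring

/-- The root group of `-α` in the adjoint representation. -/
def adNegAlpha (t : ℂ) (a : ChevalleyG2) : ChevalleyG2 :=
  ![a 0,
    a 1 + 3 * t * a 2 + 3 * t ^ 2 * a 3 + t ^ 3 * a 4,
    a 2 + 2 * t * a 3 + t ^ 2 * a 4,
    a 3 + t * a 4,
    a 4,
    a 5,
    a 6 - t * a 0,
    a 7,
    a 8 + 2 * t * a 6 - t * a 7 - t ^ 2 * a 0,
    a 9,
    a 10 + t * a 9,
    a 11 + 2 * t * a 10 + t ^ 2 * a 9,
    a 12 + 3 * t * a 11 + 3 * t ^ 2 * a 10 + t ^ 3 * a 9,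
    a 13]

/-- The root group of `-α` in the `7`-dimensional representation. -/
def matNegAlpha (t : ℂ) : Matrix (Fin 7) (Fin 7) ℂ :=
  !![1, 0, 0, 0, 0, 0, 0;
    t, 1, 0, 0, 0, 0, 0;
    0, 0, 1, 0, 0, 0, 0;
    0, 0, t, 1, 0, 0, 0;
    0, 0, t ^ 2, 2 * t, 1, 0, 0;
    0, 0, 0, 0, 0, 1, 0;
    0, 0, 0, 0, 0, t, 1]

theorem matNegAlpha_mul_neg (t : ℂ) : matNegAlpha t * matNegAlpha (-t) = 1 := by
  ext i j
  fin_cases i <;> fin_cases j <;>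
    simp [matNegAlpha, Matrix.mul_apply, Fin.sum_univ_seven] <;> ring

theorem matNegAlpha_mul_rep (t : ℂ) (a : ChevalleyG2) :
    matNegAlpha t * rep a = rep (adNegAlpha t a) * matNegAlpha t := by
  ext i j
  fin_cases i <;> fin_cases j <;>
    simp only [matNegAlpha, rep, adNegAlpha, Matrix.mul_apply, Fin.sum_univ_seven, Matrix.of_apply,
      Matrix.cons_val, Fin.reduceFinMk, Fin.zero_eta, Fin.mk_one, Fin.isValue] <;>
    ring

/-- The root group of `-β` in the adjoint representation. -/
def adNegBeta (t : ℂ) (a : ChevalleyG2) : ChevalleyG2 :=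
  ![a 0 - t * a 2,
    a 1,
    a 2,
    a 3,
    a 4 + t * a 5,
    a 5,
    a 6,
    a 7 - t * a 1,
    a 8,
    a 9 - 3 * t * a 6 + 2 * t * a 7 - t ^ 2 * a 1,
    a 10 - t * a 8,
    a 11,
    a 12,
    a 13 + t * a 12]

/-- The root group of `-β` in the `7`-dimensional representation. -/
def matNegBeta (t : ℂ) : Matrix (Fin 7) (Fin 7) ℂ :=
  !![1, 0, 0, 0, 0, 0, 0;
    0, 1, 0, 0, 0, 0, 0;
    0, t, 1, 0, 0, 0, 0;
    0, 0, 0, 1, 0, 0, 0;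
    0, 0, 0, 0, 1, 0, 0;
    0, 0, 0, 0, t, 1, 0;
    0, 0, 0, 0, 0, 0, 1]

theorem matNegBeta_mul_neg (t : ℂ) : matNegBeta t * matNegBeta (-t) = 1 := by
  ext i j
  fin_cases i <;> fin_cases j <;>
    simp [matNegBeta, Matrix.mul_apply, Fin.sum_univ_seven]

theorem matNegBeta_mul_rep (t : ℂ) (a : ChevalleyG2) :
    matNegBeta t * rep a = rep (adNegBeta t a) * matNegBeta t := by
  ext i j
  fin_cases i <;> fin_cases j <;>
    simp only [matNegBeta, rep, adNegBeta, Matrix.mul_apply, Fin.sum_univ_seven, Matrix.of_apply,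
      Matrix.cons_val, Fin.reduceFinMk, Fin.zero_eta, Fin.mk_one, Fin.isValue] <;>
    ring

/-- The Chevalley basis vectors. -/
def vec (i : Fin 14) : ChevalleyG2 := fun j => if j = i then 1 else 0

@[simp] theorem vec_apply (i j : Fin 14) : vec i j = if j = i then 1 else 0 := rfl

theorem eq_sum_vec (a : ChevalleyG2) : a = ∑ i, a i • vec i := by
  have h : ∀ (s : Finset (Fin 14)) (f : Fin 14 → ChevalleyG2) (j : Fin 14),
      (∑ i ∈ s, f i) j = ∑ i ∈ s, f i j := fun s f j => Finset.sum_apply j s f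
  ext j
  rw [h]
  simp only [smul_apply, vec_apply, mul_ite, mul_one, mul_zero]
  exact ((Finset.sum_ite_eq Finset.univ j (show Fin 14 → ℂ from a)).trans (by simp)).symm

end ChevalleyG2

section Serre

variable {L : Type*} [LieRing L] [LieAlgebra ℂ L]

/-- The brackets of the positive part of the Lie algebra of type `G₂`, deduced from the Serre
relations. -/
theorem serre_positive_brackets {x y : L} (hx : ⁅x, ⁅x, ⁅x, ⁅x, y⁆⁆⁆⁆ = 0) (hy : ⁅y, ⁅y, x⁆⁆ = 0) :
    ⁅y, ⁅x, y⁆⁆ = 0 ∧ ⁅y, ⁅x, ⁅x, y⁆⁆⁆ = 0 ∧ ⁅x, ⁅y, ⁅x, ⁅x, ⁅x, y⁆⁆⁆⁆⁆ = 0 ∧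
      ⁅y, ⁅y, ⁅x, ⁅x, ⁅x, y⁆⁆⁆⁆⁆ = 0 := by
  set z := ⁅x, y⁆ with hz
  set w := ⁅x, z⁆ with hw
  set v := ⁅x, w⁆ with hv
  have hyx : ⁅y, x⁆ = -z := (lie_skew y x).symm
  have hyz : ⁅y, z⁆ = 0 := by rw [hyx, lie_neg, neg_eq_zero] at hy; exact hy
  have hyw : ⁅y, w⁆ = 0 := by rw [hw, leibniz_lie, hyx, hyz]; simp
  have hyv : ⁅y, v⁆ = -⁅z, w⁆ := by rw [hv, leibniz_lie, hyx, hyw]; simp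
  have hzv : ⁅x, ⁅y, v⁆⁆ = ⁅z, v⁆ := by rw [leibniz_lie, hx]; simp [hz]
  have hzv' : ⁅x, ⁅y, v⁆⁆ = -⁅z, v⁆ := by rw [hyv, lie_neg, leibniz_lie, ← hw, ← hv]; simp
  refine ⟨hyz, hyw, ?_, ?_⟩
  · rw [hzv]
    have h : (2 : ℂ) • ⁅z, v⁆ = 0 := by
      rw [two_smul]; exact add_eq_zero_iff_eq_neg.mpr (hzv.symm.trans hzv')
    exact (smul_eq_zero.mp h).resolve_left two_ne_zero
  · rw [hyv, lie_neg, leibniz_lie, hyz, hyw]; simp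

/-- In a Lie algebra with elements satisfying the Serre relations of type `G₂`, a submodule
containing the fourteen standard brackets is stable under the positive generators. -/
theorem serre_lie_mem {h₁ h₂ x y f g : L}
    (hxf : ⁅x, f⁆ = h₁) (hyg : ⁅y, g⁆ = h₂) (hxg : ⁅x, g⁆ = 0) (hyf : ⁅y, f⁆ = 0)
    (h1x : ⁅h₁, x⁆ = (2 : ℂ) • x) (h1y : ⁅h₁, y⁆ = (-3 : ℂ) • y)
    (h2x : ⁅h₂, x⁆ = (-1 : ℂ) • x) (h2y : ⁅h₂, y⁆ = (2 : ℂ) • y)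
    (h1f : ⁅h₁, f⁆ = (-2 : ℂ) • f) (h1g : ⁅h₁, g⁆ = (3 : ℂ) • g)
    (h2f : ⁅h₂, f⁆ = (1 : ℂ) • f) (h2g : ⁅h₂, g⁆ = (-2 : ℂ) • g)
    (hx : ⁅x, ⁅x, ⁅x, ⁅x, y⁆⁆⁆⁆ = 0) (hy : ⁅y, ⁅y, x⁆⁆ = 0)
    (hf : ⁅f, ⁅f, ⁅f, ⁅f, g⁆⁆⁆⁆ = 0) (hg : ⁅g, ⁅g, f⁆⁆ = 0)
    {S : Submodule ℂ L} {v : Fin 14 → L} (hv : v = ![x, y, ⁅x, y⁆, ⁅x, ⁅x, y⁆⁆, ⁅x, ⁅x, ⁅x, y⁆⁆⁆,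
      ⁅y, ⁅x, ⁅x, ⁅x, y⁆⁆⁆⁆, h₁, h₂, f, g, ⁅f, g⁆, ⁅f, ⁅f, g⁆⁆, ⁅f, ⁅f, ⁅f, g⁆⁆⁆,
      ⁅g, ⁅f, ⁅f, ⁅f, g⁆⁆⁆⁆]) (hS : ∀ i, v i ∈ S) (i : Fin 14) : ⁅x, v i⁆ ∈ S ∧ ⁅y, v i⁆ ∈ S := by
  obtain ⟨p1, p2, p3, p4⟩ := serre_positive_brackets hx hy
  obtain ⟨-, q2, -, -⟩ := serre_positive_brackets hf hg
  have hyx : ⁅y, x⁆ = -⁅x, y⁆ := (lie_skew y x).symm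
  set e₃ := ⁅x, y⁆
  set e₄ := ⁅x, e₃⁆
  set e₅ := ⁅x, e₄⁆
  set e₆ := ⁅y, e₅⁆
  set f₃ := ⁅f, g⁆ with hf₃
  set f₄ := ⁅f, f₃⁆ with hf₄
  set f₅ := ⁅f, f₄⁆ with hf₅
  set f₆ := ⁅g, f₅⁆ with hf₆
  have hxh1 : ⁅x, h₁⁆ = -((2 : ℂ) • x) := by rw [← lie_skew, h1x]
  have hxh2 : ⁅x, h₂⁆ = -((-1 : ℂ) • x) := by rw [← lie_skew, h2x]
  have hyh1 : ⁅y, h₁⁆ = -((-3 : ℂ) • y) := by rw [← lie_skew, h1y]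
  have hyh2 : ⁅y, h₂⁆ = -((2 : ℂ) • y) := by rw [← lie_skew, h2y]
  have hfh2 : ⁅f, h₂⁆ = -((1 : ℂ) • f) := by rw [← lie_skew, h2f]
  have h1f₃ : ⁅h₁, f₃⁆ = (1 : ℂ) • f₃ := by
    rw [hf₃, leibniz_lie, h1f, h1g, smul_lie, lie_smul]; module
  have h1f₄ : ⁅h₁, f₄⁆ = (-1 : ℂ) • f₄ := by
    rw [hf₄, leibniz_lie, h1f, h1f₃, smul_lie, lie_smul]; module
  have h2f₃ : ⁅h₂, f₃⁆ = (-1 : ℂ) • f₃ := by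
    rw [hf₃, leibniz_lie, h2f, h2g, smul_lie, lie_smul]; module
  have h2f₄ : ⁅h₂, f₄⁆ = (0 : ℂ) • f₄ := by
    rw [hf₄, leibniz_lie, h2f, h2f₃, smul_lie, lie_smul]; module
  have h2f₅ : ⁅h₂, f₅⁆ = (1 : ℂ) • f₅ := by
    rw [hf₅, leibniz_lie, h2f, h2f₄, smul_lie, lie_smul]; module
  have xf₃ : ⁅x, f₃⁆ = (3 : ℂ) • g := by rw [hf₃, leibniz_lie, hxf, hxg, h1g]; simp
  have xf₄ : ⁅x, f₄⁆ = (4 : ℂ) • f₃ := by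
    rw [hf₄, leibniz_lie, hxf, xf₃, h1f₃, lie_smul, ← hf₃]; module
  have xf₅ : ⁅x, f₅⁆ = (3 : ℂ) • f₄ := by
    rw [hf₅, leibniz_lie, hxf, xf₄, h1f₄, lie_smul, ← hf₄]; module
  have xf₆ : ⁅x, f₆⁆ = 0 := by rw [hf₆, leibniz_lie, hxg, xf₅, lie_smul, q2]; simp
  have yf₃ : ⁅y, f₃⁆ = -((1 : ℂ) • f) := by rw [hf₃, leibniz_lie, hyf, hyg, hfh2]; simp
  have yf₄ : ⁅y, f₄⁆ = 0 := by rw [hf₄, leibniz_lie, hyf, yf₃]; simp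
  have yf₅ : ⁅y, f₅⁆ = 0 := by rw [hf₅, leibniz_lie, hyf, yf₄]; simp
  have yf₆ : ⁅y, f₆⁆ = (1 : ℂ) • f₅ := by rw [hf₆, leibniz_lie, hyg, yf₅, h2f₅]; simp
  have hm : ∀ (c : ℂ) (i : Fin 14), c • v i ∈ S := fun c i => S.smul_mem c (hS i)
  subst hv
  fin_cases i
  · exact ⟨by simp, by simpa [hyx] using hS 2⟩
  · exact ⟨hS 2, by simp⟩
  · exact ⟨hS 3, by simp [p1]⟩
  · exact ⟨hS 4, by simp [p2]⟩
  · exact ⟨by simp [hx], hS 5⟩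
  · exact ⟨by simp [p3], by simp [p4]⟩
  · exact ⟨by simpa [hxh1] using hm 2 0, by simpa [hyh1] using hm 3 1⟩
  · exact ⟨by simpa [hxh2] using hm 1 0, by simpa [hyh2] using hm 2 1⟩
  · exact ⟨by simpa [hxf] using hS 6, by simp [hyf]⟩
  · exact ⟨by simp [hxg], by simpa [hyg] using hS 7⟩
  · exact ⟨by simpa [xf₃] using hm 3 9, by simpa [yf₃] using hS 8⟩
  · exact ⟨by simpa [xf₄] using hm 4 10, by simp [yf₄]⟩
  · exact ⟨by simpa [xf₅] using hm 3 11, by simp [yf₅]⟩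
  · exact ⟨by simp [xf₆], by simpa [yf₆] using hS 12⟩

end Serre

section Presentation

open CartanMatrix

/-- The quotient map from the free Lie algebra onto `g₂`. -/
noncomputable def g2Mk : FreeLieAlgebra ℂ (Generators (Fin 2)) →ₗ⁅ℂ⁆ LieAlgebra.g₂ ℂ :=
  { (Relations.toIdeal ℂ CartanMatrix.G₂).toSubmodule.mkQ with
    map_lie' := fun {_ _} => rfl }

theorem g2Mk_surjective : Function.Surjective g2Mk :=
  Submodule.mkQ_surjective (Relations.toIdeal ℂ CartanMatrix.G₂).toSubmodule

theorem g2Mk_eq_zero {x : FreeLieAlgebra ℂ (Generators (Fin 2))}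
    (hx : x ∈ Relations.toSet ℂ CartanMatrix.G₂) : g2Mk x = 0 :=
  (Submodule.Quotient.mk_eq_zero (Relations.toIdeal ℂ CartanMatrix.G₂).toSubmodule).mpr
    (LieSubmodule.subset_lieSpan hx)

/-- The Serre generators of `g₂`. -/
noncomputable def g2Gen (x : Generators (Fin 2)) : LieAlgebra.g₂ ℂ := g2Mk (FreeLieAlgebra.of ℂ x)

open Generators in
theorem g2Gen_relations (i j : Fin 2) :
    ⁅g2Gen (H i), g2Gen (H j)⁆ = 0 ∧
    ⁅g2Gen (E i), g2Gen (F j)⁆ = (if i = j then g2Gen (H i) else 0) ∧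
    ⁅g2Gen (H i), g2Gen (E j)⁆ = (CartanMatrix.G₂ i j : ℂ) • g2Gen (E j) ∧
    ⁅g2Gen (H i), g2Gen (F j)⁆ = -((CartanMatrix.G₂ i j : ℂ) • g2Gen (F j)) ∧
    (LieAlgebra.ad ℂ (LieAlgebra.g₂ ℂ) (g2Gen (E i)) ^ (-CartanMatrix.G₂ i j).toNat)
      ⁅g2Gen (E i), g2Gen (E j)⁆ = 0 ∧
    (LieAlgebra.ad ℂ (LieAlgebra.g₂ ℂ) (g2Gen (F i)) ^ (-CartanMatrix.G₂ i j).toNat)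
      ⁅g2Gen (F i), g2Gen (F j)⁆ = 0 := by
  have hpow : ∀ (x y : FreeLieAlgebra ℂ (Generators (Fin 2))) (n : ℕ),
      g2Mk ((LieAlgebra.ad ℂ _ x ^ n) y) = (LieAlgebra.ad ℂ _ (g2Mk x) ^ n) (g2Mk y) := by
    intro x y n
    induction n with
    | zero => simp
    | succ n ih => simp [pow_succ', ih]
  refine ⟨?_, ?_, ?_, ?_, ?_, ?_⟩
  · have h := g2Mk_eq_zero (x := Relations.HH ℂ (i, j)) (by simp [Relations.toSet])
    simpa [Relations.HH, g2Gen] using h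
  · have h := g2Mk_eq_zero (x := Relations.EF ℂ (i, j)) (by simp [Relations.toSet])
    by_cases hij : i = j
    · subst hij
      simpa [Relations.EF, g2Gen, sub_eq_zero] using h
    · simpa [Relations.EF, g2Gen, hij] using h
  · have h := g2Mk_eq_zero (x := Relations.HE ℂ CartanMatrix.G₂ (i, j)) (by simp [Relations.toSet])
    simpa [Relations.HE, g2Gen, sub_eq_zero, Int.cast_smul_eq_zsmul] using h
  · have h := g2Mk_eq_zero (x := Relations.HF ℂ CartanMatrix.G₂ (i, j)) (by simp [Relations.toSet])
    simpa [Relations.HF, g2Gen, Int.cast_smul_eq_zsmul, add_eq_zero_iff_eq_neg] using h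
  · have h := g2Mk_eq_zero (x := Relations.adE ℂ CartanMatrix.G₂ (i, j)) (by simp [Relations.toSet])
    simpa [Relations.adE, g2Gen, hpow] using h
  · have h := g2Mk_eq_zero (x := Relations.adF ℂ CartanMatrix.G₂ (i, j)) (by simp [Relations.toSet])
    simpa [Relations.adF, g2Gen, hpow] using h

/-- A Lie subalgebra of `g₂` containing the Serre generators is everything. -/
theorem g2_subalgebra_eq_top {K : LieSubalgebra ℂ (LieAlgebra.g₂ ℂ)} (hK : ∀ x, g2Gen x ∈ K)
    (y : LieAlgebra.g₂ ℂ) : y ∈ K := by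
  obtain ⟨x, rfl⟩ := g2Mk_surjective y
  let f : FreeLieAlgebra ℂ (Generators (Fin 2)) →ₗ⁅ℂ⁆ K :=
    FreeLieAlgebra.lift ℂ fun x => ⟨g2Gen x, hK x⟩
  have h : K.incl.comp f = g2Mk := by
    ext x
    simp [f, g2Gen]
  rw [← h]
  exact (f x).2

/-- The fourteen standard elements of `g₂`. -/
noncomputable def g2Span : Fin 14 → LieAlgebra.g₂ ℂ :=
  let x := g2Gen (.E 0)
  let y := g2Gen (.E 1)
  let f := g2Gen (.F 0)
  let g := g2Gen (.F 1)
  ![x, y, ⁅x, y⁆, ⁅x, ⁅x, y⁆⁆, ⁅x, ⁅x, ⁅x, y⁆⁆⁆, ⁅y, ⁅x, ⁅x, ⁅x, y⁆⁆⁆⁆, g2Gen (.H 0), g2Gen (.H 1),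
    f, g, ⁅f, g⁆, ⁅f, ⁅f, g⁆⁆, ⁅f, ⁅f, ⁅f, g⁆⁆⁆, ⁅g, ⁅f, ⁅f, ⁅f, g⁆⁆⁆⁆]

theorem span_g2Span : Submodule.span ℂ (Set.range g2Span) = ⊤ := by
  set S := Submodule.span ℂ (Set.range g2Span) with hSdef
  have hS : ∀ i, g2Span i ∈ S := fun i => Submodule.subset_span ⟨i, rfl⟩
  obtain ⟨-, EF00, HE00, HF00, -, -⟩ := g2Gen_relations 0 0
  obtain ⟨-, EF01, HE01, HF01, aE01, aF01⟩ := g2Gen_relations 0 1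
  obtain ⟨-, EF10, HE10, HF10, aE10, aF10⟩ := g2Gen_relations 1 0
  obtain ⟨-, EF11, HE11, HF11, -, -⟩ := g2Gen_relations 1 1
  have c00 : CartanMatrix.G₂ 0 0 = 2 := rfl
  have c01 : CartanMatrix.G₂ 0 1 = -3 := rfl
  have c10 : CartanMatrix.G₂ 1 0 = -1 := rfl
  have c11 : CartanMatrix.G₂ 1 1 = 2 := rfl
  simp only [c00, c01, c10, c11] at *
  norm_num [pow_succ] at *
  set x := g2Gen (.E 0) with hx
  set y := g2Gen (.E 1) with hy
  set f := g2Gen (.F 0) with hf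
  set g := g2Gen (.F 1) with hg
  set h₁ := g2Gen (.H 0) with hh₁
  set h₂ := g2Gen (.H 1) with hh₂
  have hE : ∀ i, ⁅x, g2Span i⁆ ∈ S ∧ ⁅y, g2Span i⁆ ∈ S :=
    serre_lie_mem EF00 EF11 EF01 EF10 HE00 (by simpa using HE01) (by simpa using HE10) HE11
      (by simpa using HF00) HF01 (by simpa using HF10) (by simpa using HF11) aE01 aE10 aF01 aF10
      rfl hS
  let v : Fin 14 → LieAlgebra.g₂ ℂ :=
    ![f, g, ⁅f, g⁆, ⁅f, ⁅f, g⁆⁆, ⁅f, ⁅f, ⁅f, g⁆⁆⁆, ⁅g, ⁅f, ⁅f, ⁅f, g⁆⁆⁆⁆, -h₁, -h₂,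
      x, y, ⁅x, y⁆, ⁅x, ⁅x, y⁆⁆, ⁅x, ⁅x, ⁅x, y⁆⁆⁆, ⁅y, ⁅x, ⁅x, ⁅x, y⁆⁆⁆⁆]
  have hvS : ∀ i, v i ∈ S := by
    intro i
    fin_cases i
    exacts [hS 8, hS 9, hS 10, hS 11, hS 12, hS 13, S.neg_mem (hS 6), S.neg_mem (hS 7),
      hS 0, hS 1, hS 2, hS 3, hS 4, hS 5]
  have hF : ∀ i, ⁅f, v i⁆ ∈ S ∧ ⁅g, v i⁆ ∈ S :=
    serre_lie_mem (h₁ := -h₁) (h₂ := -h₂) (by rw [← lie_skew, EF00]) (by rw [← lie_skew, EF11])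
      (by rw [← lie_skew, EF10, neg_zero]) (by rw [← lie_skew, EF01, neg_zero])
      (by simp [HF00]) (by simp [HF01]) (by simp [HF10]) (by simp [HF11])
      (by simp [HE00]) (by simp [HE01]) (by simp [HE10]) (by simp [HE11])
      aF01 aF10 aE01 aE10 rfl hvS
  have hF' : ∀ i, ⁅f, g2Span i⁆ ∈ S ∧ ⁅g, g2Span i⁆ ∈ S := by
    intro i
    fin_cases i
    · exact hF 8
    · exact hF 9
    · exact hF 10
    · exact hF 11
    · exact hF 12
    · exact hF 13
    · have h := hF 6
      change ⁅f, -h₁⁆ ∈ S ∧ ⁅g, -h₁⁆ ∈ S at h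
      rwa [lie_neg, lie_neg, S.neg_mem_iff, S.neg_mem_iff] at h
    · have h := hF 7
      change ⁅f, -h₂⁆ ∈ S ∧ ⁅g, -h₂⁆ ∈ S at h
      rwa [lie_neg, lie_neg, S.neg_mem_iff, S.neg_mem_iff] at h
    · exact hF 0
    · exact hF 1
    · exact hF 2
    · exact hF 3
    · exact hF 4
    · exact hF 5
  have hstab : ∀ z : LieAlgebra.g₂ ℂ, (∀ i, ⁅z, g2Span i⁆ ∈ S) → ∀ s ∈ S, ⁅z, s⁆ ∈ S := by
    intro z hz s hs
    have : S ≤ S.comap (LieAlgebra.ad ℂ _ z : Module.End ℂ (LieAlgebra.g₂ ℂ)) := by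
      rw [hSdef, Submodule.span_le]
      rintro _ ⟨i, rfl⟩
      exact hz i
    exact this hs
  let N : LieSubalgebra ℂ (LieAlgebra.g₂ ℂ) :=
    { carrier := {z | ∀ s ∈ S, ⁅z, s⁆ ∈ S}
      add_mem' := fun {a b} ha hb s hs => by rw [add_lie]; exact S.add_mem (ha s hs) (hb s hs)
      zero_mem' := fun s hs => by rw [zero_lie]; exact S.zero_mem
      smul_mem' := fun c a ha s hs => by rw [smul_lie]; exact S.smul_mem _ (ha s hs)
      lie_mem' := fun {a b} ha hb s hs => by
        rw [lie_lie]; exact S.sub_mem (ha _ (hb s hs)) (hb _ (ha s hs)) }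
  have hEN : ∀ i : Fin 2, g2Gen (.E i) ∈ N := by
    intro i
    fin_cases i
    exacts [hstab x fun i => (hE i).1, hstab y fun i => (hE i).2]
  have hFN : ∀ i, g2Gen (.F i) ∈ N := by
    intro i
    fin_cases i
    exacts [hstab f fun i => (hF' i).1, hstab g fun i => (hF' i).2]
  have hHN : ∀ i, g2Gen (.H i) ∈ N := by
    intro i
    have h := N.lie_mem (hEN i) (hFN i)
    rwa [(g2Gen_relations i i).2.1, if_pos rfl] at h
  have hN : ∀ z, z ∈ N := g2_subalgebra_eq_top (by rintro (i | i | i); exacts [hHN i, hEN i, hFN i])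
  let K : LieSubalgebra ℂ (LieAlgebra.g₂ ℂ) :=
    { S with lie_mem' := fun {a b} _ hb => hN a b hb }
  refine eq_top_iff.mpr fun z _ => g2_subalgebra_eq_top (K := K) ?_ z
  rintro (i | i | i) <;> fin_cases i
  exacts [hS 6, hS 7, hS 0, hS 1, hS 8, hS 9]

end Presentation

section Equivalence

open CartanMatrix ChevalleyG2

/-- The images of the Serre generators in the Chevalley basis. -/
def chevalleyGen : Generators (Fin 2) → ChevalleyG2
  | .H i => vec (![6, 7] i)
  | .E i => vec (![0, 1] i)
  | .F i => vec (![8, 9] i)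

theorem lie_apply (a b : ChevalleyG2) (i : Fin 14) : ⁅a, b⁆ i = br a b i := rfl

set_option maxHeartbeats 1000000 in
theorem lie_vec :
    ⁅vec 0, vec 1⁆ = vec 2 ∧ ⁅vec 0, vec 2⁆ = (2 : ℂ) • vec 3 ∧ ⁅vec 0, vec 3⁆ = (3 : ℂ) • vec 4 ∧
    ⁅vec 0, vec 4⁆ = 0 ∧ ⁅vec 1, vec 0⁆ = -vec 2 ∧ ⁅vec 1, vec 2⁆ = 0 ∧
    ⁅vec 1, vec 4⁆ = vec 5 ∧ ⁅vec 8, vec 9⁆ = vec 10 ∧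
    ⁅vec 8, vec 10⁆ = (2 : ℂ) • vec 11 ∧ ⁅vec 8, vec 11⁆ = (3 : ℂ) • vec 12 ∧
    ⁅vec 8, vec 12⁆ = 0 ∧ ⁅vec 9, vec 8⁆ = -vec 10 ∧
    ⁅vec 9, vec 10⁆ = 0 ∧ ⁅vec 9, vec 12⁆ = vec 13 := by
  refine ⟨?_, ?_, ?_, ?_, ?_, ?_, ?_, ?_, ?_, ?_, ?_, ?_, ?_, ?_⟩ <;> ext k <;> fin_cases k <;>
    simp [lie_apply, br]

theorem chevalleyGen_eq :
    (chevalleyGen (.H 0) = vec 6 ∧ chevalleyGen (.H 1) = vec 7) ∧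
      (chevalleyGen (.E 0) = vec 0 ∧ chevalleyGen (.E 1) = vec 1) ∧
        chevalleyGen (.F 0) = vec 8 ∧ chevalleyGen (.F 1) = vec 9 :=
  ⟨⟨rfl, rfl⟩, ⟨rfl, rfl⟩, rfl, rfl⟩

set_option maxHeartbeats 1000000 in
theorem lift_chevalleyGen_eq_zero {x : FreeLieAlgebra ℂ (Generators (Fin 2))}
    (hx : x ∈ Relations.toIdeal ℂ CartanMatrix.G₂) :
    FreeLieAlgebra.lift ℂ chevalleyGen x = 0 := by
  have hpow : ∀ (x y : FreeLieAlgebra ℂ (Generators (Fin 2))) (n : ℕ),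
      FreeLieAlgebra.lift ℂ chevalleyGen ((LieAlgebra.ad ℂ _ x ^ n) y) =
        (LieAlgebra.ad ℂ _ (FreeLieAlgebra.lift ℂ chevalleyGen x) ^ n)
          (FreeLieAlgebra.lift ℂ chevalleyGen y) := by
    intro x y n
    induction n with
    | zero => simp
    | succ n ih => simp [pow_succ', ih]
  have hle : Relations.toIdeal ℂ CartanMatrix.G₂ ≤ (FreeLieAlgebra.lift ℂ chevalleyGen).ker := by
    refine LieSubmodule.lieSpan_le.mpr fun r hr => ?_
    rw [SetLike.mem_coe, LieHom.mem_ker]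
    rcases hr with ((((⟨⟨i, j⟩, rfl⟩ | ⟨⟨i, j⟩, rfl⟩) | ⟨⟨i, j⟩, rfl⟩) | ⟨⟨i, j⟩, rfl⟩) |
      ⟨⟨i, j⟩, rfl⟩) | ⟨⟨i, j⟩, rfl⟩
    · fin_cases i <;> fin_cases j <;> simp [Relations.HH, Function.uncurry, chevalleyGen_eq] <;>
        ext k <;> fin_cases k <;> simp [lie_apply, br]
    · fin_cases i <;> fin_cases j <;>
        simp [Relations.EF, Function.uncurry, chevalleyGen_eq, sub_eq_zero] <;>
        ext k <;> fin_cases k <;> simp [lie_apply, br]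
    · fin_cases i <;> fin_cases j <;>
        simp [Relations.HE, Function.uncurry, chevalleyGen_eq, sub_eq_zero, CartanMatrix.G₂,
          ← Int.cast_smul_eq_zsmul ℂ] <;>
        ext k <;> fin_cases k <;> simp [lie_apply, br]
    · fin_cases i <;> fin_cases j <;>
        simp [Relations.HF, Function.uncurry, chevalleyGen_eq, add_eq_zero_iff_eq_neg,
          CartanMatrix.G₂, ← Int.cast_smul_eq_zsmul ℂ] <;>
        ext k <;> fin_cases k <;> simp [lie_apply, br]
    · simp only [Relations.adE, Function.uncurry, Function.comp_apply, hpow, LieHom.map_lie,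
        FreeLieAlgebra.lift_of_apply]
      fin_cases i <;> fin_cases j <;> simp [CartanMatrix.G₂, pow_succ, chevalleyGen_eq, lie_vec]
    · simp only [Relations.adF, Function.uncurry, Function.comp_apply, hpow, LieHom.map_lie,
        FreeLieAlgebra.lift_of_apply]
      fin_cases i <;> fin_cases j <;> simp [CartanMatrix.G₂, pow_succ, chevalleyGen_eq, lie_vec]
  exact LieHom.mem_ker.mp (hle hx)

/-- The homomorphism from `g₂` to its model given by the Serre presentation. -/
noncomputable def g2ToChevalley : LieAlgebra.g₂ ℂ →ₗ⁅ℂ⁆ ChevalleyG2 :=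
  { Submodule.liftQ (Relations.toIdeal ℂ CartanMatrix.G₂).toSubmodule
      (FreeLieAlgebra.lift ℂ chevalleyGen).toLinearMap
      (fun _ hx => lift_chevalleyGen_eq_zero hx) with
    map_lie' := by
      intro x y
      obtain ⟨x, rfl⟩ := g2Mk_surjective x
      obtain ⟨y, rfl⟩ := g2Mk_surjective y
      exact (FreeLieAlgebra.lift ℂ chevalleyGen).map_lie x y }

theorem g2ToChevalley_gen (x : Generators (Fin 2)) :
    g2ToChevalley (g2Gen x) = chevalleyGen x :=
  FreeLieAlgebra.lift_of_apply _ x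

theorem g2ToChevalley_surjective : Function.Surjective g2ToChevalley := by
  have hgen : ∀ x, chevalleyGen x ∈ g2ToChevalley.range := fun x => ⟨g2Gen x, g2ToChevalley_gen x⟩
  have hlie : ∀ (c : ℂ) (i j k : Fin 14), vec k = c • ⁅vec i, vec j⁆ →
      vec i ∈ g2ToChevalley.range → vec j ∈ g2ToChevalley.range →
      vec k ∈ g2ToChevalley.range := fun c i j k h hi hj => by
    rw [h]; exact g2ToChevalley.range.smul_mem c (g2ToChevalley.range.lie_mem hi hj)
  have h0 : vec 0 ∈ g2ToChevalley.range := hgen (.E 0)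
  have h1 : vec 1 ∈ g2ToChevalley.range := hgen (.E 1)
  have h6 : vec 6 ∈ g2ToChevalley.range := hgen (.H 0)
  have h7 : vec 7 ∈ g2ToChevalley.range := hgen (.H 1)
  have h8 : vec 8 ∈ g2ToChevalley.range := hgen (.F 0)
  have h9 : vec 9 ∈ g2ToChevalley.range := hgen (.F 1)
  have h2 := hlie 1 0 1 2 (by simp [lie_vec]) h0 h1
  have h3 := hlie (1 / 2) 0 2 3 (by simp [lie_vec]) h0 h2
  have h4 := hlie (1 / 3) 0 3 4 (by simp [lie_vec]) h0 h3
  have h5 := hlie 1 1 4 5 (by simp [lie_vec]) h1 h4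
  have h10 := hlie 1 8 9 10 (by simp [lie_vec]) h8 h9
  have h11 := hlie (1 / 2) 8 10 11 (by simp [lie_vec]) h8 h10
  have h12 := hlie (1 / 3) 8 11 12 (by simp [lie_vec]) h8 h11
  have h13 := hlie 1 9 12 13 (by simp [lie_vec]) h9 h12
  have hvec : ∀ i, vec i ∈ g2ToChevalley.range := by
    intro i
    fin_cases i
    exacts [h0, h1, h2, h3, h4, h5, h6, h7, h8, h9, h10, h11, h12, h13]
  intro a
  change a ∈ g2ToChevalley.range
  rw [eq_sum_vec a]
  exact sum_mem fun i _ => g2ToChevalley.range.smul_mem _ (hvec i)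

/-- The algebra `g₂` defined by the Serre presentation is isomorphic to its model. -/
theorem exists_g2_equiv_chevalley : Nonempty (LieAlgebra.g₂ ℂ ≃ₗ⁅ℂ⁆ ChevalleyG2) := by
  have hfin : Module.Finite ℂ (LieAlgebra.g₂ ℂ) :=
    ⟨by rw [← span_g2Span]; exact Submodule.fg_span (Set.finite_range _)⟩
  have hle : Module.finrank ℂ (LieAlgebra.g₂ ℂ) ≤ 14 := by
    rw [← finrank_top, ← span_g2Span]
    exact (finrank_range_le_card (R := ℂ) g2Span).trans_eq (Fintype.card_fin 14)
  have hdim : Module.finrank ℂ ChevalleyG2 = 14 :=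
    (Module.finrank_fintype_fun_eq_card ℂ).trans (Fintype.card_fin 14)
  have hge := LinearMap.finrank_le_finrank_of_surjective
    (f := (g2ToChevalley : LieAlgebra.g₂ ℂ →ₗ[ℂ] ChevalleyG2)) g2ToChevalley_surjective
  have hinj : Function.Injective g2ToChevalley :=
    (LinearMap.injective_iff_surjective_of_finrank_eq_finrank
      (f := (g2ToChevalley : LieAlgebra.g₂ ℂ →ₗ[ℂ] ChevalleyG2)) (by omega)).mpr
      g2ToChevalley_surjective
  exact ⟨LieEquiv.ofBijective g2ToChevalley ⟨hinj, g2ToChevalley_surjective⟩⟩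

end Equivalence

section Reachable

variable {L L' : Type*} [LieRing L] [LieAlgebra ℂ L] [LieRing L'] [LieAlgebra ℂ L']

/-- The centralizer of an element of a complex Lie algebra. -/
def adKer (e : L) : Submodule ℂ L := LinearMap.ker (LieAlgebra.ad ℂ L e)

/-- The span of the brackets of elements of the centralizer of `e`. -/
def adKerDerived (e : L) : Submodule ℂ L :=
  Submodule.span ℂ {z | ∃ x ∈ adKer e, ∃ y ∈ adKer e, ⁅x, y⁆ = z}

theorem mem_adKer {e x : L} : x ∈ adKer e ↔ ⁅e, x⁆ = 0 := by
  rw [adKer, LinearMap.mem_ker, LieAlgebra.ad_apply]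

/-- For a nonzero nilpotent `e`, reachability amounts to the centralizer being of dimension `8`, and
then the centralizer is perfect. -/
def ReachableCriterion (e : L) : Prop :=
  e ≠ 0 → IsNilpotent (LieAlgebra.ad ℂ L e) →
    (e ∈ adKerDerived e ↔ Module.finrank ℂ (adKer e) = 8) ∧
      (Module.finrank ℂ (adKer e) = 8 → adKerDerived e = adKer e)

theorem adKer_map_equiv (φ : L ≃ₗ⁅ℂ⁆ L') (e : L) :
    adKer (φ e) = (adKer e).map (φ.toLinearEquiv : L →ₗ[ℂ] L') := by
  ext y
  rw [Submodule.mem_map_equiv, mem_adKer, mem_adKer]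
  have h : ⁅φ e, y⁆ = φ ⁅e, φ.toLinearEquiv.symm y⁆ := by
    rw [LieEquiv.map_lie]; exact congrArg _ (φ.apply_symm_apply y).symm
  rw [h]
  exact φ.toLinearEquiv.map_eq_zero_iff

theorem adKerDerived_map_equiv (φ : L ≃ₗ⁅ℂ⁆ L') (e : L) :
    adKerDerived (φ e) = (adKerDerived e).map (φ.toLinearEquiv : L →ₗ[ℂ] L') := by
  rw [adKerDerived, adKerDerived, Submodule.map_span, adKer_map_equiv]
  congr 1
  ext z
  constructor
  · rintro ⟨_, ⟨x, hx, rfl⟩, _, ⟨y, hy, rfl⟩, rfl⟩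
    exact ⟨⁅x, y⁆, ⟨x, hx, y, hy, rfl⟩, φ.map_lie x y⟩
  · rintro ⟨_, ⟨x, hx, y, hy, rfl⟩, rfl⟩
    exact ⟨_, ⟨x, hx, rfl⟩, _, ⟨y, hy, rfl⟩, (φ.map_lie x y).symm⟩

theorem ReachableCriterion.of_equiv (φ : L ≃ₗ⁅ℂ⁆ L') {e : L} (h : ReachableCriterion (φ e)) :
    ReachableCriterion e := by
  intro he hnil
  have hnil' : IsNilpotent (LieAlgebra.ad ℂ L' (φ e)) := by
    rw [← LieAlgebra.conj_ad_apply]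
    exact hnil.map (φ.toLinearEquiv.conjAlgEquiv ℂ)
  have h0 : φ e ≠ 0 := fun h0 => he (φ.toLinearEquiv.map_eq_zero_iff.mp h0)
  have := h h0 hnil'
  rw [adKerDerived_map_equiv, adKer_map_equiv, LinearEquiv.finrank_map_eq,
    Submodule.mem_map_equiv] at this
  have he' : φ.toLinearEquiv.symm (φ e) = e := φ.symm_apply_apply e
  rw [he'] at this
  exact ⟨this.1, fun h8 => Submodule.map_injective_of_injective φ.toLinearEquiv.injective (this.2 h8)⟩

/-- If the centralizer has dimension at most `7` and `e` is not reachable, the criterion holds. -/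
theorem ReachableCriterion.of_notMem {e : L} (h : e ∉ adKerDerived e)
    (h7 : Module.finrank ℂ (adKer e) ≤ 7) : ReachableCriterion e := fun _ _ =>
  ⟨⟨fun h' => absurd h' h, fun h8 => by omega⟩, fun h8 => by omega⟩

end Reachable

namespace ChevalleyG2

open Matrix

/-- An automorphism of the model induced by conjugation in the seven-dimensional representation. -/
def conjEquiv {T T' : Matrix (Fin 7) (Fin 7) ℂ} {φ φ' : ChevalleyG2 → ChevalleyG2}
    (h : T * T' = 1) (hφ : ∀ a, T * rep a = rep (φ a) * T)
    (hφ' : ∀ a, T' * rep a = rep (φ' a) * T') : ChevalleyG2 ≃ₗ⁅ℂ⁆ ChevalleyG2 :=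
  have h' : T' * T = 1 := mul_eq_one_comm.mp h
  have e : ∀ a, rep (φ a) = T * rep a * T' := fun a => by rw [hφ, mul_assoc, h, mul_one]
  have e' : ∀ a, rep (φ' a) = T' * rep a * T := fun a => by rw [hφ', mul_assoc, h', mul_one]
  { toFun := φ
    invFun := φ'
    map_add' := fun a b => rep_injective <| by
      simp only [rep_add, e, mul_add, add_mul]
    map_smul' := fun c a => rep_injective <| by
      simp only [rep_smul, e, RingHom.id_apply, Matrix.mul_smul, Matrix.smul_mul]
    map_lie' := fun {a b} => rep_injective <| by
      have hc : ∀ X Y : Matrix (Fin 7) (Fin 7) ℂ, T * X * T' * (T * Y * T') = T * (X * Y) * T' :=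
        fun X Y => by
          calc _ = T * X * (T' * T) * Y * T' := by simp only [mul_assoc]
            _ = _ := by rw [h', mul_one]; simp only [mul_assoc]
      change rep (φ (br a b)) = rep (br (φ a) (φ b))
      rw [rep_br, e, e, e, rep_br, hc, hc, mul_sub, sub_mul]
    left_inv := fun a => rep_injective <| by
      rw [e', e]
      calc _ = (T' * T) * rep a * (T' * T) := by simp only [mul_assoc]
        _ = _ := by rw [h', one_mul, mul_one]
    right_inv := fun a => rep_injective <| by
      rw [e, e']
      calc _ = (T * T') * rep a * (T * T') := by simp only [mul_assoc]
        _ = _ := by rw [h, one_mul, mul_one] }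

theorem criterion_of_alpha (t : ℂ) {a : ChevalleyG2} (h : ReachableCriterion (adAlpha t a)) :
    ReachableCriterion a :=
  h.of_equiv (conjEquiv (matAlpha_mul_neg t) (matAlpha_mul_rep t) (matAlpha_mul_rep (-t)))

theorem criterion_of_beta (t : ℂ) {a : ChevalleyG2}
    (h : ReachableCriterion (adBeta t a)) : ReachableCriterion a :=
  h.of_equiv (conjEquiv (matBeta_mul_neg t) (matBeta_mul_rep t) (matBeta_mul_rep (-t)))

theorem criterion_of_alphaBeta (t : ℂ) {a : ChevalleyG2}
    (h : ReachableCriterion (adAlphaBeta t a)) : ReachableCriterion a :=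
  h.of_equiv (conjEquiv (matAlphaBeta_mul_neg t) (matAlphaBeta_mul_rep t) (matAlphaBeta_mul_rep (-t)))

theorem criterion_of_alphaAlphaBeta (t : ℂ) {a : ChevalleyG2}
    (h : ReachableCriterion (adAlphaAlphaBeta t a)) : ReachableCriterion a :=
  h.of_equiv (conjEquiv (matAlphaAlphaBeta_mul_neg t) (matAlphaAlphaBeta_mul_rep t) (matAlphaAlphaBeta_mul_rep (-t)))

theorem criterion_of_negAlpha (t : ℂ) {a : ChevalleyG2}
    (h : ReachableCriterion (adNegAlpha t a)) : ReachableCriterion a :=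
  h.of_equiv (conjEquiv (matNegAlpha_mul_neg t) (matNegAlpha_mul_rep t) (matNegAlpha_mul_rep (-t)))

theorem criterion_of_negBeta (t : ℂ) {a : ChevalleyG2}
    (h : ReachableCriterion (adNegBeta t a)) : ReachableCriterion a :=
  h.of_equiv (conjEquiv (matNegBeta_mul_neg t) (matNegBeta_mul_rep t) (matNegBeta_mul_rep (-t)))

theorem finrank_adKer_le {a : ChevalleyG2} (s : Fin 7 → Fin 14)
    (h : ∀ x : ChevalleyG2, ⁅a, x⁆ = 0 → (∀ i, x (s i) = 0) → x = 0) :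
    Module.finrank ℂ (adKer a) ≤ 7 := by
  let f : adKer a →ₗ[ℂ] (Fin 7 → ℂ) :=
    { toFun := fun x i => x.1 (s i)
      map_add' := fun _ _ => rfl
      map_smul' := fun _ _ => rfl }
  have hf : Function.Injective f := by
    rw [injective_iff_map_eq_zero]
    exact fun x hx => Subtype.ext (h x.1 (mem_adKer.mp x.2) (congrFun hx))
  simpa using LinearMap.finrank_le_finrank_of_injective hf

theorem notMem_adKerDerived {a : ChevalleyG2} (i : Fin 14) (hi : a i ≠ 0)
    (h : ∀ x y : ChevalleyG2, ⁅a, x⁆ = 0 → ⁅a, y⁆ = 0 → br x y i = 0) : a ∉ adKerDerived a := by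
  intro ha
  let f : ChevalleyG2 →ₗ[ℂ] ℂ :=
    { toFun := fun x => x i
      map_add' := fun _ _ => rfl
      map_smul' := fun _ _ => rfl }
  have hle : adKerDerived a ≤ LinearMap.ker f := by
    refine Submodule.span_le.mpr ?_
    rintro _ ⟨x, hx, y, hy, rfl⟩
    exact h x y (mem_adKer.mp hx) (mem_adKer.mp hy)
  exact hi (hle ha)

/-- Membership in the span of the positive root spaces. -/
def IsPositive (a : ChevalleyG2) : Prop :=
  (a 6 = 0 ∧ a 7 = 0) ∧ (a 8 = 0 ∧ a 9 = 0 ∧ a 10 = 0) ∧ (a 11 = 0 ∧ a 12 = 0 ∧ a 13 = 0)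

theorem criterion_of_regular {a : ChevalleyG2} (ha : IsPositive a) (h0 : a 0 ≠ 0) (h1 : a 1 ≠ 0) :
    ReachableCriterion a := by
  obtain ⟨⟨h6, h7⟩, ⟨h8, h9, h10⟩, h11, h12, h13⟩ := ha
  have key : ∀ x : ChevalleyG2, ⁅a, x⁆ = 0 → IsPositive x := by
    intro x hx
    have e : ∀ i, br a x i = 0 := congrFun hx
    have x13 : x 13 = 0 := by simpa [br, h1, h6, h7, h8, h11, h12, h13] using e 12
    have x12 : x 12 = 0 := by simpa [br, h0, h6, h8, h10, h11, h12, h13, x13] using e 11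
    have x11 : x 11 = 0 := by simpa [br, h0, h6, h7, h8, h9, h10, h11, h13, x13] using e 10
    have x10 : x 10 = 0 := by simpa [br, h0, h6, h7, h9, h10, h13, x13] using e 9
    have x9 : x 9 = 0 := by simpa [br, h1, h9, h10, h11, h12, h13, x10, x11, x12, x13] using e 7
    have x8 : x 8 = 0 := by simpa [br, h0, h8, h10, h11, h12, h13, x10, x11, x12, x13] using e 6
    have x7 : -2 * x 6 + x 7 = 0 := by
      have := e 0
      simp [br, h6, h7, h9, h10, h11, x9, x10, x11] at this
      refine (mul_eq_zero.mp ?_).resolve_left h0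
      linear_combination this
    have x6 : 3 * x 6 - 2 * x 7 = 0 := by
      have := e 1
      simp [br, h6, h7, h8, h12, x8, x12] at this
      refine (mul_eq_zero.mp ?_).resolve_left h1
      linear_combination this
    exact ⟨⟨by linear_combination -2 * x7 - x6, by linear_combination -3 * x7 - 2 * x6⟩,
      ⟨x8, x9, x10⟩, x11, x12, x13⟩
  refine .of_notMem (notMem_adKerDerived 0 h0 fun x y hx hy => ?_)
    (finrank_adKer_le ![0, 1, 2, 3, 4, 5, 5] fun x hx hs => ?_)
  · have := key x hx
    have := key y hy
    simp_all [br, IsPositive]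
  · obtain ⟨⟨h6, h7⟩, ⟨h8, h9, h10⟩, h11, h12, h13⟩ := key x hx
    simp [Fin.forall_fin_succ] at hs
    ext i
    fin_cases i <;> simp_all

theorem criterion_of_subregular {a : ChevalleyG2} (ha : IsPositive a) (h0 : a 0 ≠ 0) (h1 : a 1 = 0)
    (h2 : a 2 = 0) (h3 : a 3 = 0) (h4 : a 4 = 0) : ReachableCriterion a := by
  obtain ⟨⟨h6, h7⟩, ⟨h8, h9, h10⟩, h11, h12, h13⟩ := ha
  have key : ∀ x : ChevalleyG2, ⁅a, x⁆ = 0 → (x 1 = 0 ∧ x 2 = 0 ∧ 3 * a 0 * x 3 = a 5 * x 9) ∧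
      (x 7 = 2 * x 6 ∧ x 8 = 0 ∧ x 10 = 0) ∧ (x 11 = 0 ∧ x 12 = 0) := by
    intro x hx
    have e : ∀ i, br a x i = 0 := congrFun hx
    have x12 : x 12 = 0 := by simpa [br, h0, h2, h6, h8, h10, h11, h12, h13] using e 11
    have x11 : x 11 = 0 := by simpa [br, h0, h3, h6, h7, h8, h9, h10, h11, h13] using e 10
    have x10 : x 10 = 0 := by simpa [br, h0, h4, h6, h7, h9, h10, h13] using e 9
    have x13 : a 5 * x 13 = 0 := by
      simpa [br, h1, h2, h3, h4, h9, h10, h11, h12, h13] using e 7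
    have x8 : x 8 = 0 := by
      simpa [br, h0, h2, h3, h4, h8, h10, h11, h12, h13, x13] using e 6
    have x1 : x 1 = 0 := by simpa [br, h0, h1, h2, h3, h6, h7, h8, h11, x11] using e 2
    have x2 : x 2 = 0 := by simpa [br, h0, h2, h3, h4, h6, h8, h10, x10] using e 3
    refine ⟨⟨x1, x2, ?_⟩, ⟨?_, x8, x10⟩, x11, x12⟩
    · have := e 4
      simp [br, h3, h4, h6, h7, h9] at this
      linear_combination this
    · have := e 0
      simp [br, h2, h3, h4, h6, h7, h9, h10, h11] at this
      refine mul_left_cancel₀ h0 ?_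
      linear_combination this
  refine .of_notMem (notMem_adKerDerived 0 h0 fun x y hx hy => ?_)
    (finrank_adKer_le ![0, 4, 5, 6, 9, 13, 13] fun x hx hs => ?_)
  · obtain ⟨⟨-, x2, -⟩, ⟨x7, x8, x10⟩, x11, x12⟩ := key x hx
    obtain ⟨⟨-, y2, -⟩, ⟨y7, y8, y10⟩, y11, y12⟩ := key y hy
    simp [br, x2, x7, x10, x11, y2, y7, y10, y11]
    ring
  · obtain ⟨⟨x1, x2, x3⟩, hx'⟩ := key x hx
    simp [Fin.forall_fin_succ] at hs
    have x3' : x 3 = 0 := by simpa [hs, h0] using x3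
    ext i
    fin_cases i <;> simp_all

theorem criterion_of_short {a : ChevalleyG2} (ha : ∀ i, i ≠ 3 → a i = 0) (h3 : a 3 ≠ 0) :
    ReachableCriterion a := by
  have key : ∀ x : ChevalleyG2, ⁅a, x⁆ = 0 → (x 0 = 0 ∧ x 2 = 0 ∧ x 6 = 0) ∧
      (x 8 = 0 ∧ x 10 = 0 ∧ x 11 = 0) ∧ (x 12 = 0 ∧ x 13 = 0) := by
    intro x hx
    have e : ∀ i, br a x i = 0 := congrFun hx
    exact ⟨⟨by simpa [br, ha, h3] using e 4, by simpa [br, ha, h3] using e 5,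
      by simpa [br, ha, h3] using e 3⟩, ⟨by simpa [br, ha, h3] using e 2,
      by simpa [br, ha, h3] using e 0, by simpa [br, ha, h3] using e 6⟩,
      by simpa [br, ha, h3] using e 8, by simpa [br, ha, h3] using e 10⟩
  refine .of_notMem (notMem_adKerDerived 3 h3 fun x y hx hy => ?_)
    (finrank_adKer_le ![1, 3, 4, 5, 7, 9, 9] fun x hx hs => ?_)
  · have hx := key x hx
    have hy := key y hy
    simp [br, hx, hy]
  · have := key x hx
    simp [Fin.forall_fin_succ] at hs
    ext i
    fin_cases i <;> simp_all

theorem mem_adKer_of_long {a : ChevalleyG2} (ha : ∀ i, i ≠ 5 → a i = 0) (h5 : a 5 ≠ 0)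
    {x : ChevalleyG2} : x ∈ adKer a ↔ ∀ i : Fin 6, x (![7, 9, 10, 11, 12, 13] i) = 0 := by
  rw [mem_adKer]
  constructor
  · intro hx
    have e : ∀ i, br a x i = 0 := congrFun hx
    intro i
    fin_cases i
    exacts [by simpa [br, ha, h5] using e 5, by simpa [br, ha, h5] using e 4,
      by simpa [br, ha, h5] using e 3, by simpa [br, ha, h5] using e 2,
      by simpa [br, ha, h5] using e 1, by simpa [br, ha, h5] using e 6]
  · intro hx
    simp [Fin.forall_fin_succ] at hx
    ext i
    rw [lie_apply]
    fin_cases i <;> simp [br, ha, hx]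

theorem criterion_of_long {a : ChevalleyG2} (ha : ∀ i, i ≠ 5 → a i = 0) (h5 : a 5 ≠ 0) :
    ReachableCriterion a := by
  have hdim : Module.finrank ℂ (adKer a) = 8 := by
    let f : ChevalleyG2 →ₗ[ℂ] (Fin 6 → ℂ) :=
      { toFun := fun x i => x (![7, 9, 10, 11, 12, 13] i)
        map_add' := fun _ _ => rfl
        map_smul' := fun _ _ => rfl }
    have hf : adKer a = LinearMap.ker f := by
      ext x
      rw [mem_adKer_of_long ha h5, LinearMap.mem_ker, funext_iff]
      rfl
    have hsurj : Function.Surjective f := fun c => by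
      refine ⟨![0, 0, 0, 0, 0, 0, 0, c 0, 0, c 1, c 2, c 3, c 4, c 5], funext fun i => ?_⟩
      fin_cases i <;> rfl
    have hdim : Module.finrank ℂ ChevalleyG2 = 14 :=
      (Module.finrank_fintype_fun_eq_card ℂ).trans (Fintype.card_fin 14)
    have := f.finrank_range_add_finrank_ker
    rw [LinearMap.range_eq_top.mpr hsurj, finrank_top, hdim, Module.finrank_fin_fun] at this
    rw [hf]
    omega
  have hle : adKerDerived a ≤ adKer a := by
    refine Submodule.span_le.mpr ?_
    rintro _ ⟨x, hx, y, hy, rfl⟩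
    rw [SetLike.mem_coe, mem_adKer, leibniz_lie, mem_adKer.mp hx, mem_adKer.mp hy]
    simp
  have hvec : ∀ i : Fin 8, vec (![0, 1, 2, 3, 4, 5, 6, 8] i) ∈ adKer a := by
    intro i
    rw [mem_adKer_of_long ha h5]
    intro j
    fin_cases i <;> fin_cases j <;> simp
  have hlie : ∀ (c : ℂ) (i j : Fin 8) (k : Fin 14),
      vec k = c • ⁅vec (![0, 1, 2, 3, 4, 5, 6, 8] i), vec (![0, 1, 2, 3, 4, 5, 6, 8] j)⁆ →
      vec k ∈ adKerDerived a := fun c i j k h => by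
    rw [h]
    exact Submodule.smul_mem _ _ (Submodule.subset_span ⟨_, hvec i, _, hvec j, rfl⟩)
  have hbr : ∀ i : Fin 8, vec (![0, 1, 2, 3, 4, 5, 6, 8] i) ∈ adKerDerived a := by
    intro i
    fin_cases i
    · refine hlie (1 / 2) 6 0 0 ?_
      ext k; fin_cases k <;> simp [lie_apply, br]
    · refine hlie (1 / 3) 7 2 1 ?_
      ext k; fin_cases k <;> simp [lie_apply, br]
    · exact hlie 1 0 1 2 (by simp [lie_vec])
    · exact hlie (1 / 2) 0 2 3 (by simp [lie_vec])
    · exact hlie (1 / 3) 0 3 4 (by simp [lie_vec])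
    · exact hlie 1 1 4 5 (by simp [lie_vec])
    · refine hlie 1 0 7 6 ?_
      ext k; fin_cases k <;> simp [lie_apply, br]
    · refine hlie (-1 / 2) 6 7 8 ?_
      ext k; fin_cases k <;> simp [lie_apply, br]
  have hge : adKer a ≤ adKerDerived a := by
    intro x hx
    rw [mem_adKer_of_long ha h5] at hx
    rw [eq_sum_vec x]
    refine Submodule.sum_mem _ fun i _ => ?_
    by_cases hi : ∃ j, ![0, 1, 2, 3, 4, 5, 6, 8] j = i
    · obtain ⟨j, rfl⟩ := hi
      exact Submodule.smul_mem _ _ (hbr j)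
    · have : x i = 0 := by
        have : ∃ j, ![7, 9, 10, 11, 12, 13] j = i := by revert i; decide
        obtain ⟨j, rfl⟩ := this
        exact hx j
      rw [this, zero_smul]
      exact Submodule.zero_mem _
  have heq := le_antisymm hle hge
  exact fun _ _ => ⟨⟨fun _ => hdim, fun _ => hge (mem_adKer.mpr (lie_self a))⟩, fun _ => heq⟩

theorem IsPositive.adAlpha {a : ChevalleyG2} (ha : IsPositive a) (t : ℂ) :
    IsPositive (adAlpha t a) := by
  simp only [IsPositive] at ha
  simp [IsPositive, ChevalleyG2.adAlpha, ha]

theorem IsPositive.adBeta {a : ChevalleyG2} (ha : IsPositive a) (t : ℂ) :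
    IsPositive (adBeta t a) := by
  simp only [IsPositive] at ha
  simp [IsPositive, ChevalleyG2.adBeta, ha]

theorem IsPositive.adAlphaBeta {a : ChevalleyG2} (ha : IsPositive a) (t : ℂ) :
    IsPositive (adAlphaBeta t a) := by
  simp only [IsPositive] at ha
  simp [IsPositive, ChevalleyG2.adAlphaBeta, ha]

theorem IsPositive.adAlphaAlphaBeta {a : ChevalleyG2} (ha : IsPositive a) (t : ℂ) :
    IsPositive (adAlphaAlphaBeta t a) := by
  simp only [IsPositive] at ha
  simp [IsPositive, ChevalleyG2.adAlphaAlphaBeta, ha]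

theorem IsPositive.adNegAlpha {a : ChevalleyG2} (ha : IsPositive a) (h0 : a 0 = 0) (t : ℂ) :
    IsPositive (adNegAlpha t a) := by
  simp only [IsPositive] at ha
  simp [IsPositive, ChevalleyG2.adNegAlpha, ha, h0]

theorem IsPositive.adNegBeta {a : ChevalleyG2} (ha : IsPositive a) (h1 : a 1 = 0) (t : ℂ) :
    IsPositive (adNegBeta t a) := by
  simp only [IsPositive] at ha
  simp [IsPositive, ChevalleyG2.adNegBeta, ha, h1]

theorem criterion_of_subregular_of_three {a : ChevalleyG2} (ha : IsPositive a) (h0 : a 0 ≠ 0)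
    (h1 : a 1 = 0) (h2 : a 2 = 0) (h3 : a 3 = 0) : ReachableCriterion a := by
  refine criterion_of_alphaAlphaBeta (a 4 / (3 * a 0))
    (criterion_of_subregular (ha.adAlphaAlphaBeta _) ?_ ?_ ?_ ?_ ?_)
  all_goals simp only [IsPositive] at ha
  · simpa [adAlphaAlphaBeta, ha] using h0
  · simp [adAlphaAlphaBeta, h1]
  · simp [adAlphaAlphaBeta, h2, ha]
  · simp [adAlphaAlphaBeta, h3, ha]
  · simp [adAlphaAlphaBeta, ha]; field_simp; ring

theorem criterion_of_subregular_of_two {a : ChevalleyG2} (ha : IsPositive a) (h0 : a 0 ≠ 0)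
    (h1 : a 1 = 0) (h2 : a 2 = 0) : ReachableCriterion a := by
  refine criterion_of_alphaBeta (a 3 / (2 * a 0))
    (criterion_of_subregular_of_three (ha.adAlphaBeta _) ?_ ?_ ?_ ?_)
  all_goals simp only [IsPositive] at ha
  · simpa [adAlphaBeta, ha] using h0
  · simp [adAlphaBeta, h1, ha]
  · simp [adAlphaBeta, h2, ha]
  · simp [adAlphaBeta, ha]; field_simp; ring

theorem criterion_of_zero_ne_zero {a : ChevalleyG2} (ha : IsPositive a) (h0 : a 0 ≠ 0) :
    ReachableCriterion a := by
  by_cases h1 : a 1 = 0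
  · refine criterion_of_beta (a 2 / a 0)
      (criterion_of_subregular_of_two (ha.adBeta _) ?_ ?_ ?_)
    all_goals simp only [IsPositive] at ha
    · simpa [adBeta] using h0
    · simp [adBeta, h1, ha]
    · simp [adBeta, h0]
  · exact criterion_of_regular ha h0 h1

theorem criterion_of_zero_one_eq_zero {a : ChevalleyG2} (ha : IsPositive a) (h0 : a 0 = 0)
    (h1 : a 1 = 0) : ReachableCriterion a := by
  by_cases h2 : a 2 = 0
  swap
  · refine criterion_of_negBeta 1 (criterion_of_zero_ne_zero (ha.adNegBeta h1 1) ?_)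
    simpa [adNegBeta, h0] using h2
  by_cases h3 : a 3 = 0
  swap
  · simp only [IsPositive] at ha
    refine criterion_of_alpha (-a 4 / (3 * a 3)) (criterion_of_alphaBeta (a 5 / (3 * a 3))
      (criterion_of_short (fun i hi => ?_) ?_))
    · fin_cases i <;> first | exact absurd rfl hi | skip
      all_goals simp [adAlpha, adAlphaBeta, h0, h1, h2, ha]
      all_goals field_simp
      all_goals ring
    · simpa [adAlpha, adAlphaBeta, h0, h1, h2, ha] using h3
  have hlong : ∀ b : ChevalleyG2, IsPositive b → b 0 = 0 → b 1 = 0 → b 2 = 0 → b 3 = 0 →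
      b 5 ≠ 0 → ReachableCriterion b := by
    intro b hb h0 h1 h2 h3 h5
    simp only [IsPositive] at hb
    refine criterion_of_negBeta (-b 4 / b 5) (criterion_of_long (fun i hi => ?_) ?_)
    · fin_cases i <;> first | exact absurd rfl hi | skip
      all_goals simp [adNegBeta, h0, h1, h2, h3, hb]
      all_goals field_simp
      all_goals ring
    · simpa [adNegBeta] using h5
  by_cases h5 : a 5 = 0
  · by_cases h4 : a 4 = 0
    · refine fun h => absurd ?_ h
      simp only [IsPositive] at ha
      ext i
      fin_cases i <;> simp [*]
    · refine criterion_of_beta 1 (hlong _ (ha.adBeta 1) h0 ?_ ?_ h3 ?_)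
      · simp only [IsPositive] at ha
        simp [adBeta, h1, ha]
      · simp [adBeta, h0, h2]
      · simpa [adBeta, h5] using h4
  · exact hlong a ha h0 h1 h2 h3 h5

theorem criterion_of_isPositive {a : ChevalleyG2} (ha : IsPositive a) : ReachableCriterion a := by
  by_cases h0 : a 0 = 0
  swap
  · exact criterion_of_zero_ne_zero ha h0
  have hcubic : ∀ b : ChevalleyG2, IsPositive b → b 0 = 0 → b 4 ≠ 0 → ReachableCriterion b := by
    intro b hb b0 b4
    obtain ⟨t, ht⟩ := IsAlgClosed.exists_root (Cubic.toPoly ⟨b 4, 3 * b 3, 3 * b 2, b 1⟩) (by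
      rw [Cubic.degree_of_a_ne_zero b4]; decide)
    refine criterion_of_negAlpha t
      (criterion_of_zero_one_eq_zero (hb.adNegAlpha b0 t) b0 ?_)
    simp [Cubic.toPoly] at ht
    simp [adNegAlpha]
    linear_combination ht
  by_cases h1 : a 1 = 0
  · exact criterion_of_zero_one_eq_zero ha h0 h1
  have hs : ∃ s : ℂ, a 4 + 3 * s * a 3 + 3 * s ^ 2 * a 2 + s ^ 3 * a 1 ≠ 0 := by
    by_contra! hs
    refine h1 ((mul_eq_zero.mp ?_).resolve_left (show (6 : ℂ) ≠ 0 by norm_num))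
    linear_combination hs 2 - 3 * hs 1 + 3 * hs 0 - hs (-1)
  obtain ⟨s, hs⟩ := hs
  refine criterion_of_alpha s (hcubic _ (ha.adAlpha s) ?_ hs)
  simp only [IsPositive] at ha
  simp [adAlpha, h0, ha]

theorem eq_zero_of_isNilpotent {a v : ChevalleyG2} (ha : IsNilpotent (LieAlgebra.ad ℂ _ a)) {c : ℂ}
    (hv : v ≠ 0) (h : ⁅a, v⁆ = c • v) : c = 0 := by
  obtain ⟨n, hn⟩ := ha
  have hpow : ∀ n : ℕ, (LieAlgebra.ad ℂ _ a ^ n) v = c ^ n • v := by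
    intro n
    induction n with
    | zero => simp
    | succ n ih =>
      rw [pow_succ', Module.End.mul_apply, ih, map_smul, LieAlgebra.ad_apply, h, smul_smul,
        pow_succ]
  have := hpow n
  rw [hn, LinearMap.zero_apply, eq_comm, smul_eq_zero] at this
  exact eq_zero_of_pow_eq_zero (this.resolve_right hv)

theorem criterion_of_borel {a : ChevalleyG2} (ha : (a 8 = 0 ∧ a 9 = 0 ∧ a 10 = 0) ∧
    (a 11 = 0 ∧ a 12 = 0 ∧ a 13 = 0)) : ReachableCriterion a := by
  intro he hnil
  have h7 : a 7 = 0 := by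
    refine eq_zero_of_isNilpotent hnil (v := vec 5) ?_ ?_
    · intro h
      simpa using congrFun h 5
    · ext i
      rw [lie_apply]
      fin_cases i <;> simp [br, ha]
  have h6 : a 6 = 0 := by
    by_contra h6
    have h : 3 * a 6 = 0 := by
      refine eq_zero_of_isNilpotent hnil
        (v := (3 * a 6) • vec 4 + a 1 • vec 5) ?_ ?_
      · intro h
        exact h6 (by simpa using congrFun h 4)
      · ext i
        rw [lie_apply]
        fin_cases i <;> simp [br, ha, h7] <;> ring
    exact h6 (by simpa using h)
  exact criterion_of_isPositive ⟨⟨h6, h7⟩, ha⟩ he hnil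

theorem criterion_of_parabolic {a : ChevalleyG2} (ha : (a 8 = 0 ∧ a 10 = 0) ∧
    (a 11 = 0 ∧ a 12 = 0 ∧ a 13 = 0)) : ReachableCriterion a := by
  have hquad : ∀ b : ChevalleyG2, (b 8 = 0 ∧ b 10 = 0) ∧ (b 11 = 0 ∧ b 12 = 0 ∧ b 13 = 0) →
      b 1 ≠ 0 → ReachableCriterion b := by
    intro b hb b1
    obtain ⟨t, ht⟩ := IsAlgClosed.exists_root
      (Polynomial.C (-b 1) * Polynomial.X ^ 2 + Polynomial.C (2 * b 7 - 3 * b 6) * Polynomial.X +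
        Polynomial.C (b 9)) (by
      rw [Polynomial.degree_quadratic (neg_ne_zero.mpr b1)]; decide)
    simp at ht
    refine criterion_of_negBeta t (criterion_of_borel ?_)
    simp [adNegBeta, hb]
    linear_combination ht
  by_cases h9 : a 9 = 0
  · exact criterion_of_borel ⟨⟨ha.1.1, h9, ha.1.2⟩, ha.2⟩
  by_cases h1 : a 1 = 0
  swap
  · exact hquad a ha h1
  by_cases h : adBeta 1 a 1 = 0
  · refine criterion_of_beta (-1) (hquad _ (by simp [adBeta, ha]) fun h' => h9 ?_)
    simp [adBeta] at h h'
    linear_combination (h + h') / (-2) + h1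
  · exact criterion_of_beta 1 (hquad _ (by simp [adBeta, ha]) h)

/-- The invariant quadratic form of the seven-dimensional representation. -/
def quad (w : Fin 7 → ℂ) : ℂ := w 0 * w 6 - w 1 * w 5 + w 2 * w 4 - w 3 ^ 2

/-- The polar form of `quad`. -/
def polar (v w : Fin 7 → ℂ) : ℂ :=
  v 0 * w 6 + v 6 * w 0 - v 1 * w 5 - v 5 * w 1 + v 2 * w 4 + v 4 * w 2 - 2 * v 3 * w 3

theorem polar_self (w : Fin 7 → ℂ) : polar w w = 2 * quad w := by
  simp only [polar, quad]; ring

theorem polar_rep (a : ChevalleyG2) (v w : Fin 7 → ℂ) :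
    polar (rep a *ᵥ v) w = -polar v (rep a *ᵥ w) := by
  simp only [polar, rep, Matrix.mulVec, dotProduct, Fin.sum_univ_seven, Matrix.of_apply,
    Matrix.cons_val]
  ring

theorem exists_isotropic_eigenvector (a : ChevalleyG2) :
    ∃ w : Fin 7 → ℂ, w ≠ 0 ∧ quad w = 0 ∧ ∃ c : ℂ, rep a *ᵥ w = c • w := by
  let f : Module.End ℂ (Fin 7 → ℂ) := (rep a).mulVecLin
  by_cases hf : LinearMap.range f = ⊥
  · refine ⟨![1, 0, 0, 0, 0, 0, 0], fun h => one_ne_zero (congrFun h 0), by simp [quad], 0, ?_⟩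
    have : rep a *ᵥ ![1, 0, 0, 0, 0, 0, 0] ∈ LinearMap.range f := ⟨_, rfl⟩
    rw [hf, Submodule.mem_bot] at this
    rw [this, zero_smul]
  · have : Nontrivial (LinearMap.range f) := Submodule.nontrivial_iff_ne_bot.mpr hf
    obtain ⟨c, hc⟩ := Module.End.exists_eigenvalue
      (f.restrict (p := LinearMap.range f) (q := LinearMap.range f) fun x _ => ⟨x, rfl⟩)
    obtain ⟨⟨w, u, hu⟩, hw⟩ := hc.exists_hasEigenvector
    have hwc : rep a *ᵥ w = c • w := congrArg Subtype.val hw.apply_eq_smul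
    refine ⟨w, fun h => hw.2 (Subtype.ext h), ?_, c, hwc⟩
    have huw : rep a *ᵥ u = w := hu
    have hsmul : ∀ v, polar v (c • w) = c * polar v w := fun v => by
      simp only [polar, Pi.smul_apply, smul_eq_mul]; ring
    have hsmul' : ∀ v, polar (c • w) v = c * polar w v := fun v => by
      simp only [polar, Pi.smul_apply, smul_eq_mul]; ring
    by_cases h0 : c = 0
    · have := polar_rep a u w
      rw [huw, hwc, hsmul, h0, polar_self] at this
      linear_combination this / 2
    · have := polar_rep a w w
      rw [hwc, hsmul, hsmul', polar_self] at this
      refine (mul_eq_zero.mp ?_).resolve_left h0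
      linear_combination this / 4

/-- The criterion holds for all elements having `w` as an eigenvector. -/
def EigenvectorCriterion (w : Fin 7 → ℂ) : Prop :=
  ∀ (a : ChevalleyG2) (c : ℂ), rep a *ᵥ w = c • w → ReachableCriterion a

theorem eigenvector_conj {T : Matrix (Fin 7) (Fin 7) ℂ} {a b : ChevalleyG2} {w : Fin 7 → ℂ} {c : ℂ}
    (hT : T * rep a = rep b * T) (h : rep a *ᵥ w = c • w) :
    rep b *ᵥ (T *ᵥ w) = c • (T *ᵥ w) := by
  rw [Matrix.mulVec_mulVec, ← hT, ← Matrix.mulVec_mulVec, h, Matrix.mulVec_smul]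

theorem matAlpha_mulVec (t : ℂ) (w : Fin 7 → ℂ) : matAlpha t *ᵥ w =
    ![w 0 + t * w 1, w 1, w 2 + 2 * t * w 3 + t ^ 2 * w 4, w 3 + t * w 4, w 4, w 5 + t * w 6,
      w 6] := by
  ext i
  fin_cases i <;> simp [matAlpha, Matrix.mulVec, dotProduct, Fin.sum_univ_seven]

theorem matNegAlpha_mulVec (t : ℂ) (w : Fin 7 → ℂ) : matNegAlpha t *ᵥ w =
    ![w 0, w 1 + t * w 0, w 2, w 3 + t * w 2, w 4 + 2 * t * w 3 + t ^ 2 * w 2, w 5,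
      w 6 + t * w 5] := by
  ext i
  fin_cases i <;> simp [matNegAlpha, Matrix.mulVec, dotProduct, Fin.sum_univ_seven] <;> ring

theorem matBeta_mulVec (t : ℂ) (w : Fin 7 → ℂ) : matBeta t *ᵥ w =
    ![w 0, w 1 + t * w 2, w 2, w 3, w 4 + t * w 5, w 5, w 6] := by
  ext i
  fin_cases i <;> simp [matBeta, Matrix.mulVec, dotProduct, Fin.sum_univ_seven]

theorem matNegBeta_mulVec (t : ℂ) (w : Fin 7 → ℂ) : matNegBeta t *ᵥ w =
    ![w 0, w 1, w 2 + t * w 1, w 3, w 4, w 5 + t * w 4, w 6] := by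
  ext i
  fin_cases i <;> simp [matNegBeta, Matrix.mulVec, dotProduct, Fin.sum_univ_seven] <;> ring

theorem EigenvectorCriterion.of_alpha (t : ℂ) {w : Fin 7 → ℂ}
    (h : EigenvectorCriterion ![w 0 + t * w 1, w 1, w 2 + 2 * t * w 3 + t ^ 2 * w 4, w 3 + t * w 4,
      w 4, w 5 + t * w 6, w 6]) : EigenvectorCriterion w := fun a c hw =>
  criterion_of_alpha t (h _ c (matAlpha_mulVec t w ▸ eigenvector_conj (matAlpha_mul_rep t a) hw))

theorem EigenvectorCriterion.of_negAlpha (t : ℂ) {w : Fin 7 → ℂ}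
    (h : EigenvectorCriterion ![w 0, w 1 + t * w 0, w 2, w 3 + t * w 2,
      w 4 + 2 * t * w 3 + t ^ 2 * w 2, w 5, w 6 + t * w 5]) : EigenvectorCriterion w :=
  fun a c hw => criterion_of_negAlpha t
    (h _ c (matNegAlpha_mulVec t w ▸ eigenvector_conj (matNegAlpha_mul_rep t a) hw))

theorem EigenvectorCriterion.of_beta (t : ℂ) {w : Fin 7 → ℂ}
    (h : EigenvectorCriterion ![w 0, w 1 + t * w 2, w 2, w 3, w 4 + t * w 5, w 5, w 6]) :
    EigenvectorCriterion w := fun a c hw =>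
  criterion_of_beta t (h _ c (matBeta_mulVec t w ▸ eigenvector_conj (matBeta_mul_rep t a) hw))

theorem EigenvectorCriterion.of_negBeta (t : ℂ) {w : Fin 7 → ℂ}
    (h : EigenvectorCriterion ![w 0, w 1, w 2 + t * w 1, w 3, w 4, w 5 + t * w 4, w 6]) :
    EigenvectorCriterion w := fun a c hw =>
  criterion_of_negBeta t
    (h _ c (matNegBeta_mulVec t w ▸ eigenvector_conj (matNegBeta_mul_rep t a) hw))

theorem eigenvectorCriterion_one {p : ℂ} (hp : p ≠ 0) :
    EigenvectorCriterion ![p, 0, 0, 0, 0, 0, 0] := by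
  intro a c h
  have e : ∀ i, (rep a *ᵥ ![p, 0, 0, 0, 0, 0, 0]) i = (c • ![p, 0, 0, 0, 0, 0, 0]) i := congrFun h
  refine criterion_of_parabolic ⟨⟨?_, ?_⟩, ?_, ?_, ?_⟩
  · simpa [rep, Matrix.mulVec, dotProduct, Fin.sum_univ_seven, hp] using e 1
  · simpa [rep, Matrix.mulVec, dotProduct, Fin.sum_univ_seven, hp] using e 2
  · simpa [rep, Matrix.mulVec, dotProduct, Fin.sum_univ_seven, hp] using e 3
  · simpa [rep, Matrix.mulVec, dotProduct, Fin.sum_univ_seven, hp] using e 4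
  · simpa [rep, Matrix.mulVec, dotProduct, Fin.sum_univ_seven, hp] using e 5

theorem eigenvectorCriterion_two {p q : ℂ} (h : p ≠ 0 ∨ q ≠ 0) :
    EigenvectorCriterion ![p, q, 0, 0, 0, 0, 0] := by
  have hne : ∀ p q : ℂ, p ≠ 0 → EigenvectorCriterion ![p, q, 0, 0, 0, 0, 0] := by
    intro p q hp
    refine .of_negAlpha (-q / p) ?_
    simpa [hp] using eigenvectorCriterion_one hp
  by_cases hp : p = 0
  · refine .of_alpha 1 ?_
    simpa using hne (p + q) q (by simpa [hp] using h)
  · exact hne p q hp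

theorem eigenvectorCriterion_three {p q r : ℂ} (h : p ≠ 0 ∨ q ≠ 0 ∨ r ≠ 0) :
    EigenvectorCriterion ![p, q, r, 0, 0, 0, 0] := by
  have hne : ∀ q r : ℂ, q ≠ 0 → EigenvectorCriterion ![p, q, r, 0, 0, 0, 0] := by
    intro q r hq
    refine .of_negBeta (-r / q) ?_
    simpa [hq] using eigenvectorCriterion_two (.inr hq)
  by_cases hr : r = 0
  · subst hr
    exact eigenvectorCriterion_two (by simpa using h)
  by_cases hq : q = 0
  · refine .of_beta 1 ?_
    simpa using hne (q + r) r (by simpa [hq] using hr)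
  · exact hne q r hq

theorem eigenvectorCriterion_five {p q r s u : ℂ} (h : p ≠ 0 ∨ q ≠ 0 ∨ r ≠ 0 ∨ u ≠ 0)
    (hquad : r * u = s ^ 2) : EigenvectorCriterion ![p, q, r, s, u, 0, 0] := by
  have hne : ∀ p r s u : ℂ, r ≠ 0 → r * u = s ^ 2 →
      EigenvectorCriterion ![p, q, r, s, u, 0, 0] := by
    intro p r s u hr hquad
    refine .of_negAlpha (-s / r) ?_
    have hu : u + 2 * (-s / r) * s + (-s / r) ^ 2 * r = 0 := by
      field_simp
      linear_combination hquad
    have := eigenvectorCriterion_three (p := p) (q := q + -s / r * p) (.inr (.inr hr))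
    simpa [hr, hu] using this
  by_cases hr : r = 0
  · have hs : s = 0 := by simpa [hr] using hquad.symm
    subst hr hs
    by_cases hu : u = 0
    · subst hu
      exact eigenvectorCriterion_three (by simpa using h)
    · refine .of_alpha 1 ?_
      simpa using hne (p + q) u u u hu (by ring)
  · exact hne p r s u hr hquad

theorem eigenvectorCriterion_six {p q r s u v : ℂ}
    (h : p ≠ 0 ∨ q ≠ 0 ∨ r ≠ 0 ∨ u ≠ 0 ∨ v ≠ 0) (hquad : r * u - q * v = s ^ 2) :
    EigenvectorCriterion ![p, q, r, s, u, v, 0] := by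
  have hne : ∀ q u : ℂ, u ≠ 0 → r * u - q * v = s ^ 2 →
      EigenvectorCriterion ![p, q, r, s, u, v, 0] := by
    intro q u hu hquad
    refine .of_negBeta (-v / u) ?_
    have := eigenvectorCriterion_five (p := p) (q := q) (r := r + -v / u * q) (s := s)
      (.inr (.inr (.inr hu))) (by field_simp; linear_combination hquad)
    simpa [hu] using this
  by_cases hv : v = 0
  · subst hv
    exact eigenvectorCriterion_five (by simpa using h) (by simpa using hquad)
  by_cases hu : u = 0
  · refine .of_beta 1 ?_
    simpa using hne (q + r) (u + v) (by simpa [hu] using hv) (by linear_combination hquad)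
  · exact hne q u hu hquad

theorem eigenvectorCriterion {w : Fin 7 → ℂ} (h : w ≠ 0) (hquad : quad w = 0) :
    EigenvectorCriterion w := by
  have hne : ∀ w : Fin 7 → ℂ, w 5 ≠ 0 → quad w = 0 → EigenvectorCriterion w := by
    intro w hw hquad
    refine .of_negAlpha (-w 6 / w 5) ?_
    have := eigenvectorCriterion_six (p := w 0) (q := w 1 + -w 6 / w 5 * w 0) (r := w 2)
      (s := w 3 + -w 6 / w 5 * w 2) (u := w 4 + 2 * (-w 6 / w 5) * w 3 + (-w 6 / w 5) ^ 2 * w 2)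
      (.inr (.inr (.inr (.inr hw)))) (by
        simp only [quad] at hquad
        field_simp
        linear_combination (w 5) ^ 2 * hquad)
    simpa [hw] using this
  by_cases h6 : w 6 = 0
  · have hw : w = ![w 0, w 1, w 2, w 3, w 4, w 5, 0] := by
      ext i; fin_cases i <;> simp [h6]
    rw [hw]
    have hquad' : w 2 * w 4 - w 1 * w 5 = w 3 ^ 2 := by
      simp only [quad] at hquad
      linear_combination hquad - w 0 * h6
    refine eigenvectorCriterion_six ?_ hquad'
    by_contra! h'
    obtain ⟨h0, h1, h2, h4, h5⟩ := h'
    have h3 : w 3 = 0 := by simpa [h1, h2] using hquad'.symm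
    exact h (by ext i; fin_cases i <;> simp [h0, h1, h2, h3, h4, h5, h6])
  by_cases h5 : w 5 = 0
  · refine .of_alpha 1 (hne _ (by simpa [h5] using h6) ?_)
    simp [quad] at hquad ⊢
    linear_combination hquad
  · exact hne w h5 hquad

theorem reachableCriterion (a : ChevalleyG2) : ReachableCriterion a := by
  obtain ⟨w, hw, hquad, c, hc⟩ := exists_isotropic_eigenvector a
  exact eigenvectorCriterion hw hquad a c hc

end ChevalleyG2

/-- In type G₂, a nonzero nilpotent `e` is reachable iff `dim g_e = 8`; moreover in that
case `g_e = [g_e, g_e]`. -/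
theorem reachable_iff_dim_G2 (e : LieAlgebra.g₂ ℂ) (he : e ≠ 0)
    (hnil : IsNilpotent (LieAlgebra.ad ℂ (LieAlgebra.g₂ ℂ) e)) :
    (e ∈ derived e ↔ Module.finrank ℂ ↥(centralizer e) = 8) ∧
      (Module.finrank ℂ ↥(centralizer e) = 8 → derived e = centralizer e) := by
  obtain ⟨φ⟩ := exists_g2_equiv_chevalley
  exact (ChevalleyG2.reachableCriterion (φ e)).of_equiv φ he hnil
end
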